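/- arXiv:0910.5009 — 12 statements merged into one kernel-verified Lean document; each statement's English description precedes it below -/
import Mathlib

section
/- There are no rational numbers y and z with 2·y² = z⁴ − 17. In particular, the Reichardt–Lind curve, given in affine form by the equation 2Y² = Z⁴ − 17, has no rational points. -/
/-- A natural number is a square modulo `m` if all its prime factors are. -/
lemma isSquare_natCast_of_prime_factors {m : ℕ} (n : ℕ) (hn : n ≠ 0)
    (h : ∀ p : ℕ, p.Prime → p ∣ n → IsSquare (p : ZMod m)) : IsSquare (n : ZMod m) := by
  induction n using Nat.recOnMul with
  | zero => exact absurd rfl hn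
  | one => simp
  | prime p hp => exact h p hp dvd_rfl
  | mul a b iha ihb =>
    obtain ⟨ha, hb⟩ := mul_ne_zero_iff.mp hn
    rw [Nat.cast_mul]
    exact (iha ha fun p hp hd => h p hp (hd.mul_right b)).mul
      (ihb hb fun p hp hd => h p hp (hd.mul_left a))

/-- A rational number whose square is half an integer is an integer. -/
lemma Rat.exists_intCast_eq_of_two_mul_sq {w : ℚ} {N : ℤ} (h : 2 * w ^ 2 = N) :
    ∃ b : ℤ, (b : ℚ) = w := by
  have hd : (w.den : ℚ) ≠ 0 := by exact_mod_cast w.den_nz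
  have key : 2 * w.num ^ 2 = N * (w.den : ℤ) ^ 2 := by
    have h' := h
    rw [← Rat.num_div_den w] at h'
    field_simp at h'
    rw [mul_comm (N : ℤ)]
    exact_mod_cast h'
  have hcop : IsCoprime ((w.den : ℤ) ^ 2) (w.num ^ 2) :=
    (Rat.isCoprime_num_den w).symm.pow
  have hdvd : (w.den : ℤ) ^ 2 ∣ 2 := hcop.dvd_of_dvd_mul_right ⟨N, by rw [key]; ring⟩
  have hle := Int.le_of_dvd two_pos hdvd
  have hpos : (0 : ℤ) < w.den := by exact_mod_cast w.den_pos
  have hone : w.den = 1 := by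
    have : (w.den : ℤ) = 1 := by nlinarith
    exact_mod_cast this
  exact ⟨w.num, Rat.den_eq_one_iff w |>.mp hone⟩

lemma isSquare_two_zmod_seventeen : IsSquare ((2 : ℕ) : ZMod 17) := ⟨6, by decide⟩

/-- `2` is not a fourth power modulo `17`. -/
lemma two_mul_pow_four_ne_pow_four_zmod_seventeen :
    ∀ x y : ZMod 17, x ≠ 0 → 2 * x ^ 4 ≠ y ^ 4 := by
  decide

/-- The homogeneous equation `2b² = a⁴ − 17c⁴` has no solution with `a` and `c` coprime. -/
lemma two_mul_sq_ne_pow_four_sub {a b c : ℤ} (hac : IsCoprime a c) :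
    2 * b ^ 2 ≠ a ^ 4 - 17 * c ^ 4 := by
  intro h
  have hp17 : Prime (17 : ℤ) := by norm_num
  have : Fact (Nat.Prime 17) := ⟨by norm_num⟩
  have hb17 : ¬ (17 : ℤ) ∣ b := by
    rintro ⟨k, rfl⟩
    obtain ⟨l, rfl⟩ : (17 : ℤ) ∣ a :=
      hp17.dvd_of_dvd_pow (n := 4) ⟨34 * k ^ 2 + c ^ 4, by linarith⟩
    have hc : (17 : ℤ) ∣ c :=
      hp17.dvd_of_dvd_pow (n := 4) ⟨17 ^ 2 * l ^ 4 - 2 * k ^ 2, by linarith⟩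
    exact hp17.not_isUnit (hac.isUnit_of_dvd' (dvd_mul_right _ _) hc)
  have hb0 : b.natAbs ≠ 0 := by
    rw [Int.natAbs_ne_zero]
    rintro rfl
    exact hb17 (dvd_zero _)
  have hsq : IsSquare (b.natAbs : ZMod 17) := by
    refine isSquare_natCast_of_prime_factors _ hb0 fun p hp hpb => ?_
    have : Fact p.Prime := ⟨hp⟩
    rcases eq_or_ne p 2 with rfl | hp2
    · exact isSquare_two_zmod_seventeen
    rw [ZMod.exists_sq_eq_prime_iff_of_mod_four_eq_one (p := 17) (by norm_num) hp2]
    have hpb' : (b : ZMod p) = 0 :=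
      (ZMod.intCast_zmod_eq_zero_iff_dvd b p).mpr (Int.natCast_dvd.mpr hpb)
    have hmod : (2 : ZMod p) * (b : ZMod p) ^ 2 = (a : ZMod p) ^ 4 - 17 * (c : ZMod p) ^ 4 := by
      exact_mod_cast congrArg (Int.cast : ℤ → ZMod p) h
    rw [hpb'] at hmod
    have hc : (c : ZMod p) ≠ 0 := by
      intro hc
      have ha : (a : ZMod p) = 0 := by
        rw [hc] at hmod
        exact pow_eq_zero_iff (n := 4) (by norm_num) |>.mp (by linear_combination -hmod)
      exact (Nat.prime_iff_prime_int.mp hp).not_isUnit (hac.isUnit_of_dvd'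
        ((ZMod.intCast_zmod_eq_zero_iff_dvd a p).mp ha)
        ((ZMod.intCast_zmod_eq_zero_iff_dvd c p).mp hc))
    refine ⟨(a : ZMod p) ^ 2 / (c : ZMod p) ^ 2, ?_⟩
    push_cast
    field_simp
    linear_combination hmod
  obtain ⟨d, hd⟩ := hsq
  have hbd : (b : ZMod 17) ^ 2 = d ^ 4 := by
    have : ((b.natAbs : ℤ) : ZMod 17) ^ 2 = (b : ZMod 17) ^ 2 := by
      exact_mod_cast congrArg (Int.cast : ℤ → ZMod 17) (Int.natAbs_sq b)
    rw [← this, Int.cast_natCast, hd]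
    ring
  have hd0 : d ≠ 0 := by
    rintro rfl
    refine hb17 ((ZMod.intCast_zmod_eq_zero_iff_dvd b 17).mp ?_)
    exact pow_eq_zero_iff (n := 2) (by norm_num) |>.mp (by rw [hbd]; ring)
  have hmod : (2 : ZMod 17) * (b : ZMod 17) ^ 2 = (a : ZMod 17) ^ 4 - 17 * (c : ZMod 17) ^ 4 := by
    exact_mod_cast congrArg (Int.cast : ℤ → ZMod 17) h
  rw [hbd, show (17 : ZMod 17) = 0 from rfl, zero_mul, sub_zero] at hmod
  exact two_mul_pow_four_ne_pow_four_zmod_seventeen d a hd0 hmod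

/-- The Reichardt–Lind curve `2Y² = Z⁴ − 17` has no rational points. -/
theorem reichardt_lind_no_rational_points :
    ¬ ∃ y z : ℚ, 2 * y ^ 2 = z ^ 4 - 17 := by
  rintro ⟨y, z, h⟩
  have hd : (z.den : ℚ) ≠ 0 := by exact_mod_cast z.den_nz
  have key : 2 * (y * (z.den : ℚ) ^ 2) ^ 2 = ((z.num ^ 4 - 17 * (z.den : ℤ) ^ 4 : ℤ) : ℚ) := by
    have hz : z * z.den = z.num := Rat.mul_den_eq_num z
    push_cast
    rw [← hz]
    linear_combination (z.den : ℚ) ^ 4 * h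
  obtain ⟨b, hb⟩ := Rat.exists_intCast_eq_of_two_mul_sq key
  rw [← hb] at key
  exact two_mul_sq_ne_pow_four_sub (Rat.isCoprime_num_den z) (by exact_mod_cast key)
end

section
/- For every prime number p there exist y, z in the field ℚ_p of p-adic numbers with 2·y² = z⁴ − 17, and there exist real numbers y, z with 2·y² = z⁴ − 17. (Together with the nonexistence of rational solutions, this exhibits the Reichardt–Lind curve as a counterexample to the Hasse local–global principle.) -/
open Polynomial in
/-- Hensel's lemma for simple roots modulo `p`. -/
theorem PadicInt.exists_root_of_toZMod {p : ℕ} [Fact p.Prime] (F : ℤ_[p][X]) (a : ℤ_[p])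
    (h₀ : PadicInt.toZMod (F.eval a) = 0) (h₁ : PadicInt.toZMod (F.derivative.eval a) ≠ 0) :
    ∃ x : ℤ_[p], F.eval x = 0 := by
  have norm_lt_iff (x : ℤ_[p]) : ‖x‖ < 1 ↔ PadicInt.toZMod x = 0 := by
    rw [← RingHom.mem_ker, PadicInt.ker_toZMod, IsLocalRing.mem_maximalIdeal,
      PadicInt.mem_nonunits]
  have hd : ‖F.derivative.eval a‖ = 1 :=
    le_antisymm (PadicInt.norm_le_one _) (not_lt.1 fun h => h₁ ((norm_lt_iff _).1 h))
  obtain ⟨x, hx, -⟩ := hensels_lemma (F := F) (a := a) (by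
    simpa only [Polynomial.coe_aeval_eq_eval, hd, one_pow] using (norm_lt_iff _).2 h₀)
  exact ⟨x, by simpa only [Polynomial.coe_aeval_eq_eval] using hx⟩

open Polynomial in
theorem PadicInt.exists_two_mul_sq_eq {p : ℕ} [Fact p.Prime] (h2 : (2 : ZMod p) ≠ 0)
    (c : ℤ_[p]) (s : ZMod p) (hs : s ≠ 0) (h : 2 * s ^ 2 = PadicInt.toZMod c) :
    ∃ y : ℤ_[p], 2 * y ^ 2 = c := by
  obtain ⟨a, rfl⟩ := ZMod.ringHom_surjective (PadicInt.toZMod (p := p)) s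
  obtain ⟨y, hy⟩ := PadicInt.exists_root_of_toZMod (2 * X ^ 2 - C c) a
    (by simp [map_ofNat, h]) (by
      have h_der : (derivative (2 * X ^ 2 - C c)).eval a = 2 * (2 * a) := by
        simp [one_add_one_eq_two]
      rw [h_der]
      simp [map_ofNat, h2, hs])
  exact ⟨y, by simpa [sub_eq_zero] using hy⟩

open Polynomial in
theorem PadicInt.exists_pow_four_eq {p : ℕ} [Fact p.Prime] (h2 : (2 : ZMod p) ≠ 0)
    (c : ℤ_[p]) (s : ZMod p) (hs : s ≠ 0) (h : s ^ 4 = PadicInt.toZMod c) :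
    ∃ z : ℤ_[p], z ^ 4 = c := by
  obtain ⟨a, rfl⟩ := ZMod.ringHom_surjective (PadicInt.toZMod (p := p)) s
  have h4 : (4 : ZMod p) ≠ 0 := by
    rw [show (4 : ZMod p) = 2 * 2 by norm_num]
    exact mul_ne_zero h2 h2
  obtain ⟨z, hz⟩ := PadicInt.exists_root_of_toZMod (X ^ 4 - C c) a
    (by simp [h]) (by
      have h_der : (derivative (X ^ 4 - C c)).eval a = 4 * a ^ 3 := by
        simp
        norm_num
      rw [h_der]
      simp [map_ofNat, h4, hs])
  exact ⟨z, by simpa [sub_eq_zero] using hz⟩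

theorem FiniteField.isSquare_mul_of_not_isSquare {K : Type*} [Field K] [Finite K] {a b : K}
    (ha : ¬IsSquare a) (hb : ¬IsSquare b) : IsSquare (a * b) := by
  classical
  have := Fintype.ofFinite K
  have hK : ringChar K ≠ 2 := fun h => ha (FiniteField.isSquare_of_char_two h a)
  have ha0 : a ≠ 0 := by rintro rfl; exact ha (IsSquare.zero)
  have hb0 : b ≠ 0 := by rintro rfl; exact hb (IsSquare.zero)
  rw [← quadraticChar_one_iff_isSquare (mul_ne_zero ha0 hb0), map_mul,
    (quadraticChar_neg_one_iff_not_isSquare).2 ha, (quadraticChar_neg_one_iff_not_isSquare).2 hb]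
  norm_num

open Polynomial in
/-- If `2` is not a square in a finite field, the affine Reichardt–Lind curve has a point. -/
theorem FiniteField.exists_two_mul_sq_eq_pow_four_sub {K : Type*} [Field K] [Finite K]
    (h2 : ¬IsSquare (2 : K)) : ∃ y z : K, 2 * y ^ 2 = z ^ 4 - 17 := by
  have := Fintype.ofFinite K
  have h20 : (2 : K) ≠ 0 := by intro h; exact h2 (h ▸ IsSquare.zero)
  have hK : ringChar K ≠ 2 := fun h => h2 (FiniteField.isSquare_of_char_two h 2)
  by_cases hneg : IsSquare (-1 : K)
  · obtain ⟨i, hi⟩ := hneg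
    have hi' : ¬IsSquare i := by
      rintro ⟨j, rfl⟩
      have hj : j ≠ 0 := by rintro rfl; simp at hi
      refine h2 ⟨j + j⁻¹, ?_⟩
      field_simp
      linear_combination hi
    by_cases h17 : IsSquare (17 : K)
    · obtain ⟨a, ha⟩ := h17
      by_cases hsq : IsSquare a
      · obtain ⟨z, rfl⟩ := hsq
        exact ⟨0, z, by linear_combination ha⟩
      · obtain ⟨c, hc⟩ := FiniteField.isSquare_mul_of_not_isSquare hi' hsq
        refine ⟨c ^ 2, c, ?_⟩
        linear_combination (-(i * a) - c * c) * hc - a * a * hi + ha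
    · obtain ⟨b, hb⟩ := FiniteField.isSquare_mul_of_not_isSquare h2 h17
      refine ⟨i * b / 2, 0, ?_⟩
      field_simp
      linear_combination -b * b * hi + hb
  · obtain ⟨w, y, h⟩ := FiniteField.exists_root_sum_quadratic
      (f := (X ^ 2 - C 17 : K[X])) (g := (C (-2) * X ^ 2 : K[X]))
      (by compute_degree!) (by compute_degree!)
      (FiniteField.odd_card_of_char_ne_two hK)
    have h' : 2 * y ^ 2 = w ^ 2 - 17 := by
      simp at h
      linear_combination -h
    by_cases hw : IsSquare w
    · obtain ⟨z, rfl⟩ := hw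
      exact ⟨y, z, by linear_combination h'⟩
    · obtain ⟨z, hz⟩ := FiniteField.isSquare_mul_of_not_isSquare hneg hw
      exact ⟨y, z, by linear_combination h' + (z * z - w) * hz⟩

theorem reichardt_lind_two_adic_point : ∃ y z : ℚ_[2], 2 * y ^ 2 = z ^ 4 - 17 := by
  obtain ⟨z, hz, -⟩ := hensels_lemma (p := 2) (R := ℤ_[2])
    (F := (Polynomial.X ^ 4 - Polynomial.C 17 : Polynomial ℤ_[2])) (a := 3) (by
      have h₁ : ‖((64 : ℤ) : ℤ_[2])‖ ≤ (2 : ℝ) ^ (-(6 : ℕ) : ℤ) := by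
        exact_mod_cast (PadicInt.norm_int_le_pow_iff_dvd (p := 2) (k := 64) (n := 6)).2 (by norm_num)
      have h₂ : ¬‖((108 : ℤ) : ℤ_[2])‖ ≤ (2 : ℝ) ^ (-(3 : ℕ) : ℤ) := by
        intro h
        have := (PadicInt.norm_int_le_pow_iff_dvd (p := 2) (k := 108) (n := 3)).1 (by exact_mod_cast h)
        norm_num at this
      norm_num at h₁ h₂ ⊢
      nlinarith)
  refine ⟨0, z, ?_⟩
  have hz' : z ^ 4 = 17 := by simpa [sub_eq_zero] using hz
  have : (z : ℚ_[2]) ^ 4 = 17 := by exact_mod_cast congrArg ((↑) : ℤ_[2] → ℚ_[2]) hz'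
  rw [this]
  norm_num

theorem reichardt_lind_odd_padic_point {p : ℕ} [Fact p.Prime] (hp : p ≠ 2) :
    ∃ y z : ℚ_[p], 2 * y ^ 2 = z ^ 4 - 17 := by
  have hpp : p.Prime := Fact.out
  have h20 : (2 : ZMod p) ≠ 0 := by
    intro h
    have := (ZMod.natCast_eq_zero_iff 2 p).1 (by exact_mod_cast h)
    exact hp ((Nat.prime_dvd_prime_iff_eq hpp Nat.prime_two).1 this)
  by_cases h2 : IsSquare (2 : ZMod p)
  · obtain ⟨r, hr⟩ := h2
    have hr0 : r ≠ 0 := by rintro rfl; simp at hr; exact h20 hr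
    obtain ⟨y, hy⟩ := PadicInt.exists_two_mul_sq_eq h20 (1 - 17 * (p : ℤ_[p]) ^ 4) r⁻¹
      (inv_ne_zero hr0) (by simp [hr]; field_simp)
    have hy' : 2 * (y : ℚ_[p]) ^ 2 = 1 - 17 * (p : ℚ_[p]) ^ 4 := by
      exact_mod_cast congrArg ((↑) : ℤ_[p] → ℚ_[p]) hy
    have hp0 : (p : ℚ_[p]) ≠ 0 := by exact_mod_cast hpp.ne_zero
    refine ⟨y / p ^ 2, 1 / p, ?_⟩
    field_simp
    linear_combination hy'
  · have h17 : (17 : ZMod p) ≠ 0 := by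
      intro h
      exact h2 ⟨6, by linear_combination -2 * h⟩
    obtain ⟨y, z, h⟩ := FiniteField.exists_two_mul_sq_eq_pow_four_sub h2
    by_cases hy : y = 0
    · subst hy
      have hz : z ≠ 0 := by rintro rfl; simp at h; exact h17 h
      obtain ⟨x, hx⟩ := PadicInt.exists_pow_four_eq h20 17 z hz
        (by simp only [map_ofNat]; linear_combination -h)
      have hx' : (x : ℚ_[p]) ^ 4 = 17 := by
        exact_mod_cast congrArg ((↑) : ℤ_[p] → ℚ_[p]) hx
      exact ⟨0, x, by linear_combination -hx'⟩
    · obtain ⟨a, rfl⟩ := ZMod.ringHom_surjective (PadicInt.toZMod (p := p)) z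
      obtain ⟨x, hx⟩ := PadicInt.exists_two_mul_sq_eq h20 (a ^ 4 - 17) y hy
        (by simpa [map_ofNat] using h)
      exact ⟨x, a, by exact_mod_cast congrArg ((↑) : ℤ_[p] → ℚ_[p]) hx⟩

/-- The Reichardt–Lind curve `2Y² = Z⁴ − 17` has points over every `ℚ_p` and over `ℝ`. -/
theorem reichardt_lind_local_points :
    (∀ (p : ℕ) [Fact p.Prime], ∃ y z : ℚ_[p], 2 * y ^ 2 = z ^ 4 - 17) ∧
    (∃ y z : ℝ, 2 * y ^ 2 = z ^ 4 - 17) := by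
  refine ⟨fun p _ => ?_, √32, 3, ?_⟩
  · by_cases hp : p = 2
    · subst hp
      convert reichardt_lind_two_adic_point
    · exact reichardt_lind_odd_padic_point hp
  · rw [Real.sq_sqrt (by norm_num)]
    norm_num
end

section
/- Let ℓ be a nonzero squarefree integer and let p be a prime number not dividing 2ℓ such that: p ≡ 1 (mod 8); p is a quadratic residue modulo every odd prime divisor q of ℓ; and ℓ is not congruent to a fourth power modulo p (there is no integer x with x⁴ ≡ ℓ (mod p)). Then there are no rational numbers y, z with y ≠ 0 and ℓ·y² = z⁴ − p. -/
/-- A natural number is a square in a commutative semiring if all its prime factors are. -/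
theorem isSquare_natCast_of_forall_prime_dvd {R : Type*} [CommSemiring R] (n : ℕ) (hn : n ≠ 0)
    (h : ∀ r : ℕ, r.Prime → r ∣ n → IsSquare (r : R)) : IsSquare (n : R) := by
  induction n using induction_on_primes with
  | zero => exact absurd rfl hn
  | one => simp
  | prime_mul r m hr ih =>
    rw [Nat.cast_mul]
    exact (h r hr (dvd_mul_right r m)).mul
      (ih (right_ne_zero_of_mul hn) fun q hq hqm => h q hq (hqm.mul_left r))

/-- A rational number whose square becomes integral after multiplication by a squarefree integer
is itself an integer. -/
theorem Rat.exists_int_eq_of_squarefree_mul_sq {l n : ℤ} (hl : Squarefree l) {x : ℚ}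
    (h : (l : ℚ) * x ^ 2 = n) : ∃ b : ℤ, x = b := by
  have hden : (x.den : ℚ) ≠ 0 := by exact_mod_cast x.den_nz
  have hmul : l * x.num ^ 2 = n * (x.den : ℤ) ^ 2 := by
    rw [← Rat.num_div_den x, div_pow, mul_div_assoc', div_eq_iff (pow_ne_zero 2 hden)] at h
    exact_mod_cast h
  have hcop : IsCoprime ((x.den : ℤ) ^ 2) (x.num ^ 2) := x.isCoprime_num_den.symm.pow
  have hdvd : (x.den : ℤ) ^ 2 ∣ l := hcop.dvd_of_dvd_mul_right ⟨n, by rw [hmul, mul_comm]⟩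
  have hunit : IsUnit (x.den : ℤ) := hl _ (by rwa [← sq])
  have hone : x.den = 1 := by simpa using Int.isUnit_iff_natAbs_eq.mp hunit
  exact ⟨x.num, ((Rat.den_eq_one_iff x).mp hone).symm⟩

/-- If `p ≡ 1 (mod 8)` and `b ∣ a⁴ - p c⁴` with `a`, `c` coprime and `p ∤ b`, then `b` is a square
modulo `p`. -/
theorem isSquare_zmod_of_dvd_pow_four_sub {p : ℕ} [Fact p.Prime] (hp8 : p % 8 = 1)
    {a b c : ℤ} (hac : IsCoprime a c) (hb : b ≠ 0) (hpb : ¬ (p : ℤ) ∣ b)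
    (hdvd : b ∣ a ^ 4 - p * c ^ 4) : IsSquare (b.natAbs : ZMod p) := by
  refine isSquare_natCast_of_forall_prime_dvd _ (Int.natAbs_ne_zero.mpr hb) fun r hr hrb => ?_
  have := Fact.mk hr
  have hp2 : p ≠ 2 := by rintro rfl; omega
  have hrb' : (r : ℤ) ∣ b := Int.natCast_dvd.mpr hrb
  rcases eq_or_ne r 2 with rfl | hr2
  · exact_mod_cast (ZMod.exists_sq_eq_two_iff hp2).mpr (Or.inl hp8)
  · rw [ZMod.exists_sq_eq_prime_iff_of_mod_four_eq_one (by omega) hr2]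
    have heq : (a : ZMod r) ^ 4 = p * (c : ZMod r) ^ 4 := by
      have h0 := (ZMod.intCast_zmod_eq_zero_iff_dvd _ r).mpr (hrb'.trans hdvd)
      push_cast at h0
      exact sub_eq_zero.mp h0
    have hc : (c : ZMod r) ≠ 0 := by
      intro hc
      have ha : (a : ZMod r) = 0 := by simpa [hc] using heq
      rw [ZMod.intCast_zmod_eq_zero_iff_dvd] at ha hc
      exact (Nat.prime_iff_prime_int.mp hr).not_isUnit (hac.isUnit_of_dvd' ha hc)
    refine ⟨(a : ZMod r) ^ 2 / (c : ZMod r) ^ 2, ?_⟩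
    field_simp
    exact heq.symm

/-- The integral form of the result: a primitive integral solution of `ℓ b² = a⁴ - p c⁴` with
`b ≠ 0` forces `ℓ` to be a fourth power modulo `p`. -/
theorem exists_pow_four_modEq_of_mul_sq_eq {p : ℕ} (hp : p.Prime) (hp8 : p % 8 = 1)
    {l a b c : ℤ} (hac : IsCoprime a c) (hb : b ≠ 0)
    (h : l * b ^ 2 = a ^ 4 - p * c ^ 4) : ∃ x : ℤ, x ^ 4 ≡ l [ZMOD (p : ℤ)] := by
  have := Fact.mk hp
  have hpp : Prime (p : ℤ) := Nat.prime_iff_prime_int.mp hp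
  have hpb : ¬ (p : ℤ) ∣ b := by
    rintro ⟨b, rfl⟩
    have ha : (p : ℤ) ∣ a :=
      hpp.dvd_of_dvd_pow (n := 4) ⟨l * p * b ^ 2 + c ^ 4, by linear_combination -h⟩
    obtain ⟨a, rfl⟩ := ha
    have hc : (p : ℤ) ∣ c := by
      refine hpp.dvd_of_dvd_pow (n := 4) ⟨p ^ 2 * a ^ 4 - l * b ^ 2, ?_⟩
      exact mul_left_cancel₀ hpp.ne_zero (by linear_combination h)
    exact hpp.not_isUnit (hac.isUnit_of_dvd' (dvd_mul_right _ _) hc)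
  obtain ⟨s, hs⟩ := isSquare_zmod_of_dvd_pow_four_sub hp8 hac hb hpb
    ⟨l * b, by linear_combination -h⟩
  have hbs : (b : ZMod p) ^ 2 = s ^ 4 := by
    have hsq : ((b.natAbs : ℤ) : ZMod p) ^ 2 = (b : ZMod p) ^ 2 := by
      exact_mod_cast congrArg (Int.cast : ℤ → ZMod p) (Int.natAbs_sq b)
    rw [← hsq, Int.cast_natCast, hs]
    ring
  have hs0 : s ≠ 0 := by
    rintro rfl
    refine hpb ((ZMod.intCast_zmod_eq_zero_iff_dvd _ p).mp ?_)
    simpa using hbs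
  have heq : (l : ZMod p) * s ^ 4 = (a : ZMod p) ^ 4 := by
    have h0 := congrArg (Int.cast : ℤ → ZMod p) h
    push_cast at h0
    rw [← hbs, h0, CharP.cast_eq_zero, zero_mul, sub_zero]
  obtain ⟨x, hx⟩ := ZMod.intCast_surjective ((a : ZMod p) / s)
  refine ⟨x, (ZMod.intCast_eq_intCast_iff _ _ _).mp ?_⟩
  rw [Int.cast_pow, hx, div_pow, ← heq]
  field_simp

/-- Arithmetic twists of the Reichardt–Lind curve `ℓY² = Z⁴ − p`, `Y ≠ 0`,
have no rational points under the stated conditions on `ℓ` and `p`. -/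
theorem twisted_reichardt_lind_no_rational_points
    (ℓ : ℤ) (hℓ : Squarefree ℓ) (hℓ0 : ℓ ≠ 0)
    (p : ℕ) (hp : p.Prime) (hpℓ : ¬ (p : ℤ) ∣ 2 * ℓ)
    (hp8 : p % 8 = 1)
    (hQR : ∀ q : ℕ, q.Prime → Odd q → (q : ℤ) ∣ ℓ → ∃ x : ℤ, x ^ 2 ≡ (p : ℤ) [ZMOD q])
    (h4 : ¬ ∃ x : ℤ, x ^ 4 ≡ ℓ [ZMOD (p : ℤ)]) :
    ¬ ∃ y z : ℚ, y ≠ 0 ∧ (ℓ : ℚ) * y ^ 2 = z ^ 4 - (p : ℚ) := by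
  rintro ⟨y, z, hy, h⟩
  have hden : (z.den : ℚ) ≠ 0 := by exact_mod_cast z.den_nz
  have hscaled : (ℓ : ℚ) * (y * (z.den : ℚ) ^ 2) ^ 2
      = ((z.num ^ 4 - p * (z.den : ℤ) ^ 4 : ℤ) : ℚ) := by
    push_cast
    rw [← Rat.mul_den_eq_num z]
    linear_combination (z.den : ℚ) ^ 4 * h
  obtain ⟨b, hb⟩ := Rat.exists_int_eq_of_squarefree_mul_sq hℓ hscaled
  have hb0 : b ≠ 0 := by
    rintro rfl
    exact mul_ne_zero hy (pow_ne_zero 2 hden) (by simpa using hb)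
  rw [hb] at hscaled
  exact h4 (exists_pow_four_modEq_of_mul_sq_eq hp hp8
    z.isCoprime_num_den hb0 (by exact_mod_cast hscaled))
end

section
/- Let p and q be coprime integers, not both zero. Then the integers A = p² + pq + 3q² and B = p² + pq + q² are both odd and are coprime to each other. (Consequently, for t = p/q the rational number N(t) = (1 + 2/(1+t+t²))⁴ + 16 satisfies N(t)·B⁴ = A⁴ + 16·B⁴ with A, B odd and coprime.) -/
theorem odd_sq_add_mul_add_sq {p q : ℤ} (hpq : IsCoprime p q) :
    Odd (p ^ 2 + p * q + q ^ 2) := by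
  have h : ¬ (Even p ∧ Even q) := by
    rintro ⟨hp, hq⟩
    have h2 := hpq.isUnit_of_dvd' hp.two_dvd hq.two_dvd
    exact Int.prime_two.not_isUnit h2
  rw [← Int.not_even_iff_odd]
  simp only [Int.even_add, Int.even_mul, Int.even_pow]
  tauto

theorem isCoprime_sq_add_mul_add_sq_right {p q : ℤ} (hpq : IsCoprime p q) :
    IsCoprime (p ^ 2 + p * q + q ^ 2) q := by
  have h : IsCoprime (p ^ 2 + q * (p + q)) q := hpq.pow_left.add_mul_left_left (p + q)
  convert h using 1
  ring

/-- For coprime integers `p`, `q`, not both zero, the integers `A = p² + pq + 3q²`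
and `B = p² + pq + q²` are both odd and coprime to each other. -/
theorem elkies_numerator_denominator_odd_coprime
    (p q : ℤ) (hpq : IsCoprime p q) (h0 : ¬ (p = 0 ∧ q = 0)) :
    Odd (p ^ 2 + p * q + 3 * q ^ 2) ∧ Odd (p ^ 2 + p * q + q ^ 2) ∧
      IsCoprime (p ^ 2 + p * q + 3 * q ^ 2) (p ^ 2 + p * q + q ^ 2) := by
  have hB := odd_sq_add_mul_add_sq hpq
  have hA : p ^ 2 + p * q + 3 * q ^ 2 = 2 * q ^ 2 + (p ^ 2 + p * q + q ^ 2) * 1 := by ring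
  refine ⟨?_, hB, ?_⟩
  · rw [hA, mul_one]
    exact (even_two_mul _).add_odd hB
  · rw [hA]
    refine IsCoprime.add_mul_left_left (IsCoprime.mul_left ?_ ?_) 1
    · exact Int.isCoprime_two_left.mpr hB
    · exact (isCoprime_sq_add_mul_add_sq_right hpq).symm.pow_left
end

section
/- Every prime number p with p ≡ 1 (mod 8) can be written as p = a² + 16·b² for some integers a and b with a odd. -/
theorem Nat.four_dvd_of_odd_of_sq_add_sq_mod_eight {x y : ℕ} (hx : Odd x)
    (h : (x ^ 2 + y ^ 2) % 8 = 1) : 4 ∣ y := by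
  have hx8 : x % 8 = 1 ∨ x % 8 = 3 ∨ x % 8 = 5 ∨ x % 8 = 7 := by
    have := Nat.odd_iff.mp hx
    omega
  have hy8 : y % 8 < 8 := Nat.mod_lt _ (by norm_num)
  rw [Nat.dvd_iff_mod_eq_zero]
  rw [Nat.add_mod, Nat.pow_mod, Nat.pow_mod y] at h
  generalize hr : y % 8 = r at *
  rcases hx8 with hx8 | hx8 | hx8 | hx8 <;> rw [hx8] at h <;> interval_cases r <;> omega

theorem Nat.exists_eq_sq_add_sixteen_mul_sq_of_odd {n x y : ℕ} (hx : Odd x)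
    (hn : n % 8 = 1) (h : x ^ 2 + y ^ 2 = n) :
    ∃ a b : ℤ, Odd a ∧ (n : ℤ) = a ^ 2 + 16 * b ^ 2 := by
  subst h
  obtain ⟨b, rfl⟩ := Nat.four_dvd_of_odd_of_sq_add_sq_mod_eight hx hn
  exact ⟨x, b, mod_cast hx, by push_cast; ring⟩

/-- Every prime `p ≡ 1 mod 8` can be written as `p = a² + 16b²` with `a` odd. -/
theorem prime_one_mod_eight_eq_sq_add_sixteen_sq
    (p : ℕ) (hp : p.Prime) (hp8 : p % 8 = 1) :
    ∃ a b : ℤ, Odd a ∧ (p : ℤ) = a ^ 2 + 16 * b ^ 2 := by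
  have : Fact p.Prime := ⟨hp⟩
  obtain ⟨x, y, h⟩ := Nat.Prime.sq_add_sq (p := p) (by omega)
  rcases Nat.even_or_odd x with hx | hx
  · have hy : Odd y := by
      have hodd : Odd (x ^ 2 + y ^ 2) := by
        rw [h, Nat.odd_iff]
        omega
      by_contra hy
      rw [Nat.not_odd_iff_even] at hy
      exact Nat.not_even_iff_odd.mpr hodd
        ((hx.pow_of_ne_zero two_ne_zero).add (hy.pow_of_ne_zero two_ne_zero))
    exact Nat.exists_eq_sq_add_sixteen_mul_sq_of_odd hy hp8 (by rw [add_comm, h])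
  · exact Nat.exists_eq_sq_add_sixteen_mul_sq_of_odd hx hp8 h
end

section
/- Let p be a prime number written as p = a² + 16·b² with integers a, b and a odd. Then 2 is a fourth power modulo p (there exists an integer x with x⁴ ≡ 2 (mod p)) if and only if b is even. -/
/-- The Jacobi symbol of a perfect square is `1` as soon as it does not vanish. -/
theorem jacobiSym_sq_eq_one_of_ne_zero {m : ℤ} {n : ℕ} (h : jacobiSym (m ^ 2) n ≠ 0) :
    jacobiSym (m ^ 2) n = 1 := by
  rw [jacobiSym.pow_left] at h ⊢
  rcases jacobiSym.trichotomy m n with h0 | h0 | h0 <;> simp_all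

/-- Quadratic reciprocity for an odd integer of either sign against a modulus `1 mod 4`. -/
theorem jacobiSym_eq_jacobiSym_natAbs {p : ℕ} (hp : p % 4 = 1) {m : ℤ} (hm : Odd m) :
    jacobiSym m p = jacobiSym p m.natAbs := by
  have hp2 : Odd p := Nat.odd_iff.mpr (by omega)
  have hn : Odd m.natAbs := Int.natAbs_odd.mpr hm
  rw [jacobiSym.quadratic_reciprocity_one_mod_four hp hn]
  rcases Int.natAbs_eq m with h | h
  · rw [← h]
  · conv_lhs => rw [h]
    rw [jacobiSym.neg _ hp2, ZMod.χ₄_nat_one_mod_four hp, one_mul]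

/-- For odd `n`, the value `χ₈ n` is determined by `n ^ 2` modulo `16`. -/
theorem chi_eight_of_sq_eq {n : ℕ} {j : ℤ} (h : (n : ℤ) ^ 2 = 8 * j + 1) :
    ZMod.χ₈ n = if Even j then 1 else -1 := by
  rw [ZMod.χ₈_nat_eq_if_mod_eight]
  have hn : n % 2 = 1 := by
    rcases Nat.even_or_odd' n with ⟨k, rfl | rfl⟩
    · push_cast at h
      ring_nf at h
      omega
    · omega
  obtain ⟨q, r, hr, hnq⟩ : ∃ q r : ℕ, r < 8 ∧ n = 8 * q + r :=
    ⟨n / 8, n % 8, Nat.mod_lt _ (by norm_num), (Nat.div_add_mod n 8).symm⟩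
  subst hnq
  push_cast at h
  ring_nf at h
  simp only [Int.even_iff]
  interval_cases r <;> norm_num at h <;> split_ifs <;> omega

/-- In a prime field with `p = 8k + 1` elements, the quadratic character of a primitive eighth root
of unity is `(-1) ^ k`. -/
theorem quadraticChar_of_pow_four_eq_neg_one {p k : ℕ} [Fact p.Prime] (hk : p = 8 * k + 1)
    {g : ZMod p} (hg : g ^ 4 = -1) :
    quadraticChar (ZMod p) g = if Even k then 1 else -1 := by
  have hchar : ringChar (ZMod p) ≠ 2 := by
    rw [ZMod.ringChar_zmod_n]
    omega
  have hg0 : g ≠ 0 := by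
    rintro rfl
    simp at hg
  have hpow : g ^ (Fintype.card (ZMod p) / 2) = (-1) ^ k := by
    rw [ZMod.card, show p / 2 = 4 * k by omega, pow_mul, hg]
  rw [quadraticChar_eq_pow_of_char_ne_two hchar hg0, hpow]
  have hne : (-1 : ZMod p) ≠ 1 := Ring.neg_one_ne_one_of_char_ne_two hchar
  rcases Nat.even_or_odd k with h | h
  · simp [h]
  · simp [h.neg_one_pow, Nat.not_even_iff_odd.mpr h, hne]

/-- If `s ^ 2 = 2 * u ^ 2` with `s` and `u` nonzero, then `2` is a fourth power exactly when `s` and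
`u` have the same quadratic character, provided that `-1` is a square. -/
theorem exists_pow_four_eq_two_iff_quadraticChar_eq {F : Type*} [Field F] [Fintype F]
    [DecidableEq F] (hneg : quadraticChar F (-1) = 1) {s u : F} (hs : s ≠ 0) (hu : u ≠ 0)
    (h : s ^ 2 = 2 * u ^ 2) :
    (∃ x : F, x ^ 4 = 2) ↔ quadraticChar F s = quadraticChar F u := by
  constructor
  · rintro ⟨x, hx⟩
    have hx0 : x ≠ 0 := by
      rintro rfl
      apply hs
      have h2 : (2 : F) = 0 := by simpa using hx.symm
      simpa [h2] using h
    have hsq : s ^ 2 = (x ^ 2 * u) ^ 2 := by rw [h, ← hx]; ring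
    rcases sq_eq_sq_iff_eq_or_eq_neg.mp hsq with e | e
    · rw [e, map_mul, quadraticChar_sq_one' hx0, one_mul]
    · rw [e, neg_eq_neg_one_mul, map_mul, hneg, one_mul, map_mul, quadraticChar_sq_one' hx0,
        one_mul]
  · intro hχ
    have hone : quadraticChar F (s * u) = 1 := by
      rw [map_mul, hχ, ← sq, quadraticChar_sq_one hu]
    obtain ⟨y, hy⟩ := (quadraticChar_one_iff_isSquare (mul_ne_zero hs hu)).mp hone
    refine ⟨y / u, ?_⟩
    have hy4 : y ^ 4 = (s * u) ^ 2 := by rw [hy]; ring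
    rw [div_pow, hy4, mul_pow, h]
    field_simp

/-- For a prime `p = a² + 16b²` with `a` odd, `2` is a fourth power mod `p`
iff `b` is even. -/
theorem two_is_fourth_power_iff_even
    (p : ℕ) (hp : p.Prime) (a b : ℤ) (ha : Odd a)
    (hrep : (p : ℤ) = a ^ 2 + 16 * b ^ 2) :
    (∃ x : ℤ, x ^ 4 ≡ 2 [ZMOD (p : ℤ)]) ↔ Even b := by
  have : Fact p.Prime := ⟨hp⟩
  obtain ⟨k, hk⟩ : ∃ k, p = 8 * k + 1 := by
    obtain ⟨t, rfl⟩ := ha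
    obtain ⟨r, hr⟩ := Int.even_mul_succ_self t
    have : (p : ℤ) = 8 * (r + 2 * b ^ 2) + 1 := by rw [hrep]; linear_combination 4 * hr
    exact ⟨p / 8, by omega⟩
  have hp4 : p % 4 = 1 := by omega
  have hrepF : (a : ZMod p) ^ 2 + 16 * (b : ZMod p) ^ 2 = 0 := by
    have h := congrArg (Int.cast : ℤ → ZMod p) hrep
    push_cast at h
    rw [← h, ZMod.natCast_self]
  have hchar : ringChar (ZMod p) ≠ 2 := by
    rw [ZMod.ringChar_zmod_n]
    omega
  have h2 : (2 : ZMod p) ≠ 0 := Ring.two_ne_zero hchar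
  have ha0 : (a : ZMod p) ≠ 0 := by
    intro h
    have hb : (b : ZMod p) = 0 := by
      have h16 : (2 : ZMod p) ^ 4 * (b : ZMod p) ^ 2 = 0 := by
        rw [h] at hrepF
        linear_combination hrepF
      simpa [h2] using h16
    rw [ZMod.intCast_zmod_eq_zero_iff_dvd] at h hb
    obtain ⟨c, rfl⟩ := h
    obtain ⟨d, rfl⟩ := hb
    have hp0 : (p : ℤ) ≠ 0 := by exact_mod_cast hp.ne_zero
    have hdvd : (p : ℤ) * (c ^ 2 + 16 * d ^ 2) = 1 := by
      apply mul_left_cancel₀ hp0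
      linear_combination -hrep
    have := Int.isUnit_iff.mp (IsUnit.of_mul_eq_one _ hdvd)
    have := hp.two_le
    omega
  set f : ZMod p := 4 * b / a with hf
  have hfa : f * a = 4 * b := div_mul_cancel₀ _ ha0
  have hf2 : f ^ 2 = -1 := by
    rw [hf, div_pow, div_eq_iff (pow_ne_zero 2 ha0)]
    linear_combination hrepF
  have hf0 : f ≠ 0 := by
    intro h
    simp [h] at hf2
  obtain ⟨g, hg⟩ : IsSquare f := by
    rw [ZMod.euler_criterion p hf0, show p / 2 = 2 * (2 * k) by omega, pow_mul, hf2]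
    simp
  have hg4 : g ^ 4 = -1 := by
    rw [← hf2, hg]
    ring
  have hg0 : g ≠ 0 := by
    rintro rfl
    simp at hg4
  set m : ℤ := a + 4 * b with hm
  have hmodd : Odd m := ha.add_even ⟨2 * b, by ring⟩
  have hmsq : (m : ZMod p) ^ 2 = 2 * ((a : ZMod p) * g) ^ 2 := by
    rw [hm]
    push_cast
    linear_combination hrepF - 2 * a * hfa + 2 * a ^ 2 * hg
  have hm0 : (m : ZMod p) ≠ 0 := by
    intro h
    rw [h] at hmsq
    have : (2 : ZMod p) * (a * g) ^ 2 ≠ 0 :=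
      mul_ne_zero h2 (pow_ne_zero 2 (mul_ne_zero ha0 hg0))
    exact this (by rw [← hmsq]; ring)
  have hχ (z : ℤ) : quadraticChar (ZMod p) z = jacobiSym z p := by
    rw [← jacobiSym.legendreSym.to_jacobiSym]
    rfl
  have hne {z : ℤ} (hz : (z : ZMod p) ≠ 0) : jacobiSym z p ≠ 0 := by
    rw [← hχ]
    exact quadraticChar_eq_zero_iff.not.mpr hz
  have hχa : quadraticChar (ZMod p) a = 1 := by
    have hna := hne ha0
    have hmod : jacobiSym p a.natAbs = jacobiSym ((4 * b) ^ 2) a.natAbs := by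
      apply jacobiSym.mod_left'
      apply Int.ModEq.symm
      rw [Int.modEq_iff_dvd, Int.natAbs_dvd]
      exact ⟨a, by rw [hrep]; ring⟩
    rw [hχ]
    rw [jacobiSym_eq_jacobiSym_natAbs hp4 ha, hmod] at hna ⊢
    exact jacobiSym_sq_eq_one_of_ne_zero hna
  have hχm : quadraticChar (ZMod p) m = ZMod.χ₈ m.natAbs := by
    have hnm := hne hm0
    have hodd : Odd m.natAbs := Int.natAbs_odd.mpr hmodd
    rw [hχ, ← jacobiSym.at_two hodd]
    rw [jacobiSym_eq_jacobiSym_natAbs hp4 hmodd] at hnm ⊢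
    have h2n : jacobiSym 2 m.natAbs ≠ 0 :=
      jacobiSym.ne_zero (by
        rw [Int.gcd_eq_natAbs]
        exact Nat.coprime_two_left.mpr hodd)
    have hmod : jacobiSym (2 * p) m.natAbs = jacobiSym ((a - 4 * b) ^ 2) m.natAbs := by
      apply jacobiSym.mod_left'
      apply Int.ModEq.symm
      rw [Int.modEq_iff_dvd, Int.natAbs_dvd]
      exact ⟨m, by rw [hrep, hm]; ring⟩
    have hprod : jacobiSym 2 m.natAbs * jacobiSym p m.natAbs = 1 := by
      have hnz := mul_ne_zero h2n hnm
      rw [← jacobiSym.mul_left, hmod] at hnz ⊢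
      exact jacobiSym_sq_eq_one_of_ne_zero hnz
    exact (Int.eq_of_mul_eq_one hprod).symm
  have hneg : quadraticChar (ZMod p) (-1) = 1 := by
    have h := hχ (-1)
    rwa [jacobiSym.at_neg_one (Nat.odd_iff.mpr (by omega)), ZMod.χ₄_nat_one_mod_four hp4,
      Int.cast_neg, Int.cast_one] at h
  have hn8 : (m.natAbs : ℤ) ^ 2 = 8 * (k + a * b) + 1 := by
    rw [Int.natAbs_sq, hm]
    have : (p : ℤ) = 8 * k + 1 := by exact_mod_cast hk
    linear_combination this - hrep
  have hcast : (∃ x : ℤ, x ^ 4 ≡ 2 [ZMOD (p : ℤ)]) ↔ ∃ x : ZMod p, x ^ 4 = 2 := by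
    rw [(ZMod.intCast_surjective (n := p)).exists]
    simp [← ZMod.intCast_eq_intCast_iff]
  rw [hcast, exists_pow_four_eq_two_iff_quadraticChar_eq hneg hm0 (mul_ne_zero ha0 hg0) hmsq,
    map_mul, hχa, one_mul, hχm, quadraticChar_of_pow_four_eq_neg_one hk hg4,
    chi_eight_of_sq_eq hn8]
  have hab : Even (a * b) ↔ Even b := by
    simp [Int.even_mul, Int.not_even_iff_odd.mpr ha]
  have hadd : Even (k + a * b) ↔ (Even k ↔ Even (a * b)) := by
    rw [Int.even_add, Int.even_coe_nat]
  rw [← hab]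
  split_ifs <;> simp_all
end

section
/- Let A and B be odd coprime integers and set N₀ = A⁴ + 16·B⁴. Then the number of primes p such that the p-adic valuation v_p(N₀) is odd and 2 is not a fourth power modulo p is odd. -/
/-- The Jacobi symbol is multiplicative over finite products in its lower argument. -/
theorem jacobiSym_finset_prod_right {ι : Type*} (m : ℤ) (s : Finset ι) (f : ι → ℕ)
    (hf : ∀ i ∈ s, f i ≠ 0) : jacobiSym m (∏ i ∈ s, f i) = ∏ i ∈ s, jacobiSym m (f i) := by
  classical
  induction s using Finset.induction_on with
  | empty => simp
  | insert i s hi ih =>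
    have hs : ∀ j ∈ s, f j ≠ 0 := fun j hj => hf j (Finset.mem_insert_of_mem hj)
    rw [Finset.prod_insert hi, Finset.prod_insert hi, ← ih hs,
      jacobiSym.mul_right' m (hf i (Finset.mem_insert_self i s)) (Finset.prod_ne_zero_iff.mpr hs)]

/-- If `a⁴ + 16b⁴ = 0` in a field, then `2` is a fourth power if and only if
`ab(a² + 4b²)` is a square. -/
theorem exists_pow_four_eq_two_iff {F : Type*} [Field F] (h2 : (2 : F) ≠ 0) {a b : F}
    (hb : b ≠ 0) (h : a ^ 4 + 16 * b ^ 4 = 0) :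
    (∃ x : F, x ^ 4 = 2) ↔ IsSquare (a * b * (a ^ 2 + 4 * b ^ 2)) := by
  obtain ⟨z, rfl⟩ : ∃ z, a = 2 * b * z := ⟨a / (2 * b), by field_simp⟩
  have hz : z ^ 4 = -1 := by
    have h' : (2 * b) ^ 4 * (z ^ 4 + 1) = 0 := by linear_combination h
    have := (mul_eq_zero.mp h').resolve_left (pow_ne_zero 4 (mul_ne_zero h2 hb))
    linear_combination this
  have hz0 : z ≠ 0 := by
    rintro rfl
    norm_num at hz
  obtain ⟨s, hs⟩ : ∃ s, z ^ 2 + 1 = z * s := ⟨(z ^ 2 + 1) / z, by field_simp⟩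
  have hs2 : s ^ 2 = 2 := by
    have h' : z ^ 2 * (s ^ 2 - 2) = 0 := by
      linear_combination hz - (z * s + z ^ 2 + 1) * hs
    have := (mul_eq_zero.mp h').resolve_left (pow_ne_zero 2 hz0)
    linear_combination this
  have hs0 : s ≠ 0 := by
    rintro rfl
    exact h2 (by linear_combination -hs2)
  have hm : 2 * b * z * b * ((2 * b * z) ^ 2 + 4 * b ^ 2) = s * (2 * s * z * b ^ 2) ^ 2 := by
    linear_combination 8 * b ^ 4 * z * hs - 4 * s * z ^ 2 * b ^ 4 * hs2
  rw [hm]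
  have hc : 2 * s * z * b ^ 2 ≠ 0 := by positivity
  constructor
  · rintro ⟨x, hx⟩
    have hx' : (x ^ 2 - s) * (x ^ 2 + s) = 0 := by linear_combination hx - hs2
    rcases mul_eq_zero.mp hx' with hx | hx
    · exact ⟨x * (2 * s * z * b ^ 2), by
        linear_combination -(2 * s * z * b ^ 2) ^ 2 * hx⟩
    · exact ⟨z ^ 2 * x * (2 * s * z * b ^ 2), by
        linear_combination (2 * s * z * b ^ 2) ^ 2 * (hx - x ^ 2 * hz)⟩
  · rintro ⟨t, ht⟩
    refine ⟨t / (2 * s * z * b ^ 2), ?_⟩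
    have : (t / (2 * s * z * b ^ 2)) ^ 2 = s := by
      rw [div_pow, div_eq_iff (pow_ne_zero 2 hc), ht, sq]
    calc (t / (2 * s * z * b ^ 2)) ^ 4 = ((t / (2 * s * z * b ^ 2)) ^ 2) ^ 2 := by ring
      _ = 2 := by rw [this, hs2]

/-- Multiplying the upper argument by a coprime square does not change the Jacobi symbol. -/
theorem jacobiSym_eq_of_modEq_mul_sq {c k x : ℤ} {n : ℕ} (h : c ≡ k * x ^ 2 [ZMOD n])
    (hx : IsCoprime x n) : jacobiSym c n = jacobiSym k n := by
  rw [jacobiSym.mod_left' h, jacobiSym.mul_left,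
    jacobiSym.sq_one' (Int.isCoprime_iff_gcd_eq_one.mp hx), mul_one]

/-- For odd coprime `a`, `b`, the Jacobi symbol of `ab(a² + 4b²)` over `a⁴ + 16b⁴` is `-1`. -/
theorem jacobiSym_mul_sq_add_four_mul_sq {a b : ℕ} (ha : Odd a) (hb : Odd b)
    (hab : a.Coprime b) :
    jacobiSym ((a * b * (a ^ 2 + 4 * b ^ 2) : ℕ) : ℤ) (a ^ 4 + 16 * b ^ 4) = -1 := by
  have odd_sq_mod {n : ℕ} (hn : Odd n) : n ^ 2 % 8 = 1 := by
    have hn := Nat.odd_iff.mp hn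
    have : n % 8 = 1 ∨ n % 8 = 3 ∨ n % 8 = 5 ∨ n % 8 = 7 := by omega
    rcases this with h | h | h | h <;> simp [Nat.pow_mod, h]
  have ha8 := odd_sq_mod ha
  have hb8 := odd_sq_mod hb
  have hN4 : (a ^ 4 + 16 * b ^ 4) % 4 = 1 := by
    have : a ^ 4 % 8 = 1 := by
      rw [show a ^ 4 = (a ^ 2) ^ 2 by ring, Nat.pow_mod, ha8]
    omega
  have hc8 : (a ^ 2 + 4 * b ^ 2) % 8 = 5 := by omega
  have hc : Odd (a ^ 2 + 4 * b ^ 2) := Nat.odd_iff.mpr (by omega)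
  have hab' : IsCoprime (a : ℤ) b := Nat.isCoprime_iff_coprime.mpr hab
  have two_coprime {n : ℕ} (hn : Odd n) : IsCoprime (2 : ℤ) n :=
    Nat.isCoprime_iff_coprime.mpr (Nat.coprime_two_left.mpr hn)
  have h2b (n : ℕ) (hn : Odd n) (hbn : IsCoprime (b : ℤ) n) :
      IsCoprime ((2 * b) ^ 2 : ℤ) n := ((two_coprime hn).mul_left hbn).pow_left
  have hJa : jacobiSym ((a ^ 4 + 16 * b ^ 4 : ℕ) : ℤ) a = 1 := by
    rw [jacobiSym_eq_of_modEq_mul_sq (k := 1) (x := (2 * b) ^ 2) _ (h2b a ha hab'.symm),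
      jacobiSym.one_left]
    exact Int.modEq_iff_dvd.mpr ⟨-a ^ 3, by push_cast; ring⟩
  have hJb : jacobiSym ((a ^ 4 + 16 * b ^ 4 : ℕ) : ℤ) b = 1 := by
    rw [jacobiSym_eq_of_modEq_mul_sq (k := 1) (x := a ^ 2) _ hab'.pow_left,
      jacobiSym.one_left]
    exact Int.modEq_iff_dvd.mpr ⟨-(16 * b ^ 3), by push_cast; ring⟩
  have hbc : IsCoprime (b : ℤ) (a ^ 2 + 4 * b ^ 2 : ℕ) := by
    have : IsCoprime (b : ℤ) (a ^ 2 + b * (4 * b)) :=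
      (IsCoprime.add_mul_left_right_iff).mpr hab'.symm.pow_right
    convert this using 1
    push_cast
    ring
  have hJc : jacobiSym ((a ^ 4 + 16 * b ^ 4 : ℕ) : ℤ) (a ^ 2 + 4 * b ^ 2) = -1 := by
    rw [jacobiSym_eq_of_modEq_mul_sq (k := 2) (x := (2 * b) ^ 2) _ (h2b _ hc hbc),
      jacobiSym.at_two hc, ZMod.χ₈_nat_mod_eight, hc8]
    · rfl
    · exact Int.modEq_iff_dvd.mpr ⟨4 * b ^ 2 - a ^ 2, by push_cast; ring⟩
  rw [Nat.cast_mul, Nat.cast_mul, jacobiSym.mul_left, jacobiSym.mul_left,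
    ← jacobiSym.quadratic_reciprocity_one_mod_four hN4 ha,
    ← jacobiSym.quadratic_reciprocity_one_mod_four hN4 hb,
    ← jacobiSym.quadratic_reciprocity_one_mod_four hN4 hc, hJa, hJb, hJc]
  norm_num

/-- For a prime `p` dividing `a⁴ + 16b⁴`, the Legendre symbol of `ab(a² + 4b²)` detects whether
`2` is a fourth power modulo `p`. -/
theorem jacobiSym_prime_eq_ite {a b p : ℕ} (ha : Odd a) (hab : a.Coprime b)
    (hp : p.Prime) (hpN : p ∣ a ^ 4 + 16 * b ^ 4)
    (h0 : jacobiSym ((a * b * (a ^ 2 + 4 * b ^ 2) : ℕ) : ℤ) p ≠ 0)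
    [Decidable (∃ x : ℤ, x ^ 4 ≡ 2 [ZMOD (p : ℤ)])] :
    jacobiSym ((a * b * (a ^ 2 + 4 * b ^ 2) : ℕ) : ℤ) p =
      if ∃ x : ℤ, x ^ 4 ≡ 2 [ZMOD (p : ℤ)] then 1 else -1 := by
  have : Fact p.Prime := ⟨hp⟩
  have h2 : (2 : ZMod p) ≠ 0 := by
    intro h
    have hp2 : p ∣ 2 := (ZMod.natCast_eq_zero_iff 2 p).mp (by exact_mod_cast h)
    obtain rfl := (Nat.prime_dvd_prime_iff_eq hp Nat.prime_two).mp hp2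
    have : Even (16 * b ^ 4) := (by decide : Even 16).mul_right _
    exact Nat.not_even_iff_odd.mpr (ha.pow.add_even this) (even_iff_two_dvd.mpr hpN)
  have hb : (b : ZMod p) ≠ 0 := by
    intro h
    have hpb : p ∣ b := (ZMod.natCast_eq_zero_iff b p).mp h
    have hpa : p ∣ a := hp.dvd_of_dvd_pow
      ((Nat.dvd_add_left ((hpb.pow (by norm_num)).mul_left 16)).mp hpN)
    exact Nat.not_coprime_of_dvd_of_dvd hp.one_lt hpa hpb hab
  have hN : (a : ZMod p) ^ 4 + 16 * (b : ZMod p) ^ 4 = 0 := by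
    exact_mod_cast (ZMod.natCast_eq_zero_iff _ p).mpr hpN
  have hx : (∃ x : ℤ, x ^ 4 ≡ 2 [ZMOD (p : ℤ)]) ↔ ∃ x : ZMod p, x ^ 4 = 2 := by
    rw [(ZMod.intCast_surjective).exists]
    refine exists_congr fun x => ?_
    rw [← ZMod.intCast_eq_intCast_iff]
    push_cast
    rfl
  have hsq := hx.trans (exists_pow_four_eq_two_iff h2 hb hN)
  have hneg := ZMod.nonsquare_iff_jacobiSym_eq_neg_one (p := p)
    (a := ((a * b * (a ^ 2 + 4 * b ^ 2) : ℕ) : ℤ))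
  push_cast at hneg h0 ⊢
  split_ifs with h
  · exact ((jacobiSym.trichotomy _ p).resolve_left h0).resolve_right
      fun h' => hneg.mp h' (hsq.mp h)
  · exact hneg.mpr (mt hsq.mpr h)

/-- For odd coprime integers `A`, `B` and `N₀ = A⁴ + 16B⁴`, the number of primes
`p` with `v_p(N₀)` odd and `2` not a fourth power mod `p` is odd. -/
theorem odd_number_of_bad_primes
    (A B : ℤ) (hA : Odd A) (hB : Odd B) (hAB : IsCoprime A B) :
    Odd (Set.ncard {p : ℕ | p.Prime ∧ Odd (padicValInt p (A ^ 4 + 16 * B ^ 4)) ∧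
      ¬ ∃ x : ℤ, x ^ 4 ≡ 2 [ZMOD (p : ℤ)]}) := by
  classical
  set a := A.natAbs with ha_def
  set b := B.natAbs with hb_def
  have ha : Odd a := Int.natAbs_odd.mpr hA
  have hb : Odd b := Int.natAbs_odd.mpr hB
  have hab : a.Coprime b := Int.isCoprime_iff_gcd_eq_one.mp hAB
  set N := a ^ 4 + 16 * b ^ 4 with hN_def
  have hN : A ^ 4 + 16 * B ^ 4 = (N : ℤ) := by
    rw [hN_def, ha_def, hb_def]
    push_cast
    simp [Even.pow_abs (by decide : Even 4)]
  have hN0 : N ≠ 0 := by have := ha.pos; positivity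
  have hset : {p : ℕ | p.Prime ∧ Odd (padicValInt p (A ^ 4 + 16 * B ^ 4)) ∧
      ¬ ∃ x : ℤ, x ^ 4 ≡ 2 [ZMOD (p : ℤ)]} =
      ({p ∈ N.primeFactors | Odd (N.factorization p) ∧
        ¬ ∃ x : ℤ, x ^ 4 ≡ 2 [ZMOD (p : ℤ)]} : Finset ℕ) := by
    ext p
    simp only [Set.mem_ofPred_eq, Finset.coe_filter, hN, padicValInt.of_nat, Nat.mem_primeFactors]
    constructor
    · rintro ⟨hp, ho, hx⟩
      rw [← Nat.factorization_def _ hp] at ho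
      exact ⟨⟨hp, Nat.dvd_of_factorization_pos ho.pos.ne', hN0⟩, ho, hx⟩
    · rintro ⟨⟨hp, -, -⟩, ho, hx⟩
      rw [Nat.factorization_def _ hp] at ho
      exact ⟨hp, ho, hx⟩
  rw [hset, Set.ncard_coe_finset]
  have hJ := jacobiSym_mul_sq_add_four_mul_sq ha hb hab
  rw [← hN_def] at hJ
  set m : ℤ := ((a * b * (a ^ 2 + 4 * b ^ 2) : ℕ) : ℤ) with hm
  have hprod : jacobiSym m N = ∏ p ∈ N.primeFactors, jacobiSym m p ^ N.factorization p := by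
    conv_lhs => rw [← Nat.prod_factorization_pow_eq_self hN0]
    rw [Finsupp.prod, Nat.support_factorization, jacobiSym_finset_prod_right]
    · exact Finset.prod_congr rfl fun p _ => jacobiSym.pow_right m p _
    · exact fun p hp => pow_ne_zero _ (Nat.prime_of_mem_primeFactors hp).ne_zero
  have hne : ∀ p ∈ N.primeFactors, jacobiSym m p ^ N.factorization p ≠ 0 :=
    Finset.prod_ne_zero_iff.mp (by rw [← hprod, hJ]; norm_num)
  have hval : ∀ p ∈ N.primeFactors, jacobiSym m p ^ N.factorization p =
      if Odd (N.factorization p) ∧ ¬ ∃ x : ℤ, x ^ 4 ≡ 2 [ZMOD (p : ℤ)] then -1 else 1 := by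
    intro p hp
    have hpN := Nat.mem_primeFactors.mp hp
    have hv : N.factorization p ≠ 0 :=
      (hpN.1.factorization_pos_of_dvd hN0 hpN.2.1).ne'
    rw [jacobiSym_prime_eq_ite ha hab hpN.1 hpN.2.1 ((pow_ne_zero_iff hv).mp (hne p hp))]
    by_cases hx : ∃ x : ℤ, x ^ 4 ≡ 2 [ZMOD (p : ℤ)]
    · simp only [hx, if_true, one_pow, not_true, and_false, if_false]
    · rcases Nat.even_or_odd (N.factorization p) with he | ho
      · simp only [hx, if_false, he.neg_one_pow, Nat.not_odd_iff_even.mpr he, false_and]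
      · simp only [hx, if_false, ho.neg_one_pow, ho, not_false_eq_true, and_self, if_true]
  rw [hprod, Finset.prod_congr rfl hval, Finset.prod_ite, Finset.prod_const, Finset.prod_const_one,
    mul_one] at hJ
  exact (neg_one_pow_eq_neg_one_iff_odd (by norm_num : (-1 : ℤ) ≠ 1)).mp hJ
end

section
/- For every rational number t there are no rational numbers y, z with y ≠ 0 and 2·y² = z⁴ − N(t), where N(t) = (1 + 2/(1+t+t²))⁴ + 16. That is, every member of Elkies' isotrivial family of arithmetic twists of the affine Reichardt–Lind curve has no rational points. -/
open scoped NumberTheorySymbols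

/-- If `a * v ^ 2` is congruent to `b * u ^ 2` modulo a prime `q` and `a`, `v` are units
modulo `q`, then `a` and `b` have the same quadratic character. -/
lemma jacobiSym_eq_of_dvd_mul_sq_sub {q : ℕ} (hq : q.Prime) {a b u v : ℤ}
    (ha : ¬ (q : ℤ) ∣ a) (hv : ¬ (q : ℤ) ∣ v) (h : (q : ℤ) ∣ a * v ^ 2 - b * u ^ 2) :
    J(a | q) = J(b | q) := by
  have hqZ : Prime (q : ℤ) := Nat.prime_iff_prime_int.mp hq
  have hu : ¬ (q : ℤ) ∣ u := by
    intro hu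
    have h2 : (q : ℤ) ∣ a * v ^ 2 := by
      have := dvd_add h ((dvd_pow hu two_ne_zero).mul_left b)
      simpa using this
    rcases hqZ.dvd_or_dvd h2 with h3 | h3
    · exact ha h3
    · exact hv (hqZ.dvd_of_dvd_pow h3)
  have gcd_one : ∀ x : ℤ, ¬ (q : ℤ) ∣ x → x.gcd q = 1 := by
    intro x hx
    rw [← Int.isCoprime_iff_gcd_eq_one]
    exact ((Prime.coprime_iff_not_dvd hqZ).mpr hx).symm
  have key : J(a * v ^ 2 | q) = J(b * u ^ 2 | q) :=
    jacobiSym.mod_left' (Int.emod_eq_emod_iff_emod_sub_eq_zero.mpr (Int.emod_eq_zero_of_dvd h))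
  rw [jacobiSym.mul_left, jacobiSym.mul_left, jacobiSym.sq_one' (gcd_one v hv),
    jacobiSym.sq_one' (gcd_one u hu)] at key
  simpa using key

/-- If every odd prime factor of `y` has `m ≡ 1 [MOD 8]` as a quadratic residue, then
`y` has trivial Jacobi symbol modulo `m`. -/
lemma jacobiSym_eq_one_of_forall_prime_left {m : ℕ} (hm : m % 8 = 1) (y : ℕ) (hy : y ≠ 0)
    (h : ∀ q : ℕ, q.Prime → q ≠ 2 → q ∣ y → J(m | q) = 1) : J(y | m) = 1 := by
  induction y using induction_on_primes with
  | zero => exact absurd rfl hy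
  | one => simp
  | prime_mul p a hp ih =>
    have hp' : p.Prime := hp
    rw [Nat.cast_mul, jacobiSym.mul_left,
      ih (right_ne_zero_of_mul hy) fun q hq hq2 hqa => h q hq hq2 (hqa.mul_left p), mul_one]
    rcases eq_or_ne p 2 with rfl | hp2
    · rw [Nat.cast_ofNat, jacobiSym.at_two (Nat.odd_iff.mpr (by lia)),
        ZMod.χ₈_nat_eq_if_mod_eight]
      simp [hm, show m % 2 = 1 by lia]
    · rw [← jacobiSym.quadratic_reciprocity_one_mod_four (by lia) (hp'.odd_of_ne_two hp2)]
      exact h p hp' hp2 (dvd_mul_right p a)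

lemma jacobiSym_eq_one_of_forall_prime_right {a : ℤ} (m : ℕ) (hm : m ≠ 0)
    (h : ∀ q : ℕ, q.Prime → q ∣ m → J(a | q) = 1) : J(a | m) = 1 := by
  induction m using induction_on_primes with
  | zero => exact absurd rfl hm
  | one => simp
  | prime_mul p b hp ih =>
    have hb := right_ne_zero_of_mul hm
    rw [jacobiSym.mul_right' a hp.ne_zero hb, h p hp (dvd_mul_right p b),
      ih hb fun q hq hqb => h q hq (hqb.mul_left p), mul_one]

lemma pow_four_add_mod_eight {A : ℕ} (B : ℕ) (hA : Odd A) : (A ^ 4 + 16 * B ^ 4) % 8 = 1 := by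
  have h : A % 8 = 1 ∨ A % 8 = 3 ∨ A % 8 = 5 ∨ A % 8 = 7 := by
    have := Nat.odd_iff.mp hA
    lia
  have h4 : A ^ 4 % 8 = 1 := by
    rcases h with h | h | h | h <;> simp [Nat.pow_mod, h]
  lia

lemma coprime_pow_four_add {A B : ℕ} (hA : Odd A) (hAB : A.Coprime B) :
    A.Coprime (A ^ 4 + 16 * B ^ 4) ∧ B.Coprime (A ^ 4 + 16 * B ^ 4) ∧
      (A ^ 2 + 4 * B ^ 2).Coprime (A ^ 4 + 16 * B ^ 4) := by
  have key : ∀ q : ℕ, q.Prime → q ∣ A ^ 4 + 16 * B ^ 4 → ¬ q ∣ 2 ∧ ¬ q ∣ A ∧ ¬ q ∣ B := by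
    intro q hq hqN
    have h2 : ¬ q ∣ 2 := fun h => by
      rw [(Nat.prime_dvd_prime_iff_eq hq Nat.prime_two).mp h] at hqN
      have := pow_four_add_mod_eight B hA
      lia
    have h16 : ¬ q ∣ 16 := fun h => h2 (hq.dvd_of_dvd_pow (m := 2) (n := 4) h)
    have not_both : ¬ (q ∣ A ∧ q ∣ B) := fun h =>
      hq.one_lt.ne' (Nat.dvd_one.mp (hAB ▸ Nat.dvd_gcd h.1 h.2))
    have hqA : ¬ q ∣ A := fun h => by
      have := (Nat.dvd_add_right (dvd_pow h four_ne_zero)).mp hqN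
      rcases hq.dvd_mul.mp this with h' | h'
      · exact h16 h'
      · exact not_both ⟨h, hq.dvd_of_dvd_pow h'⟩
    refine ⟨h2, hqA, fun h => hqA ?_⟩
    exact hq.dvd_of_dvd_pow ((Nat.dvd_add_left ((dvd_pow h four_ne_zero).mul_left 16)).mp hqN)
  refine ⟨Nat.coprime_of_dvd fun q hq h hN => (key q hq hN).2.1 h,
    Nat.coprime_of_dvd fun q hq h hN => (key q hq hN).2.2 h,
    Nat.coprime_of_dvd fun q hq h hN => ?_⟩
  obtain ⟨h2, hqA, hqB⟩ := key q hq hN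
  have h8 : q ∣ 8 * (A ^ 2 * B ^ 2) := by
    refine (Nat.dvd_add_right hN).mp ?_
    rw [show A ^ 4 + 16 * B ^ 4 + 8 * (A ^ 2 * B ^ 2) =
      (A ^ 2 + 4 * B ^ 2) * (A ^ 2 + 4 * B ^ 2) by ring]
    exact h.mul_right _
  rcases hq.dvd_mul.mp h8 with h' | h'
  · exact h2 (hq.dvd_of_dvd_pow (m := 2) (n := 3) h')
  · rcases hq.dvd_mul.mp h' with h' | h'
    · exact hqA (hq.dvd_of_dvd_pow h')
    · exact hqB (hq.dvd_of_dvd_pow h')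

lemma jacobiSym_pow_four_add {A B : ℕ} (hA : Odd A) (hB : Odd B) (hAB : A.Coprime B) :
    J(((A ^ 2 + 4 * B ^ 2 : ℕ) : ℤ) * (A * B) | A ^ 4 + 16 * B ^ 4) = -1 := by
  have hN := pow_four_add_mod_eight B hA
  have hDodd : Odd (A ^ 2 + 4 * B ^ 2) := (hA.pow).add_even (by simp [Nat.even_mul]; left; decide)
  obtain ⟨-, -, hDN⟩ := coprime_pow_four_add hA hAB
  have hDmod : (A ^ 2 + 4 * B ^ 2) % 8 = 5 := by
    obtain ⟨a, rfl⟩ := hA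
    obtain ⟨b, rfl⟩ := hB
    have ha : (2 * a + 1) ^ 2 = 4 * (a * (a + 1)) + 1 := by ring
    have hb : (2 * b + 1) ^ 2 = 4 * (b * (b + 1)) + 1 := by ring
    have := Nat.even_iff.mp (Nat.even_mul_succ_self a)
    lia
  have hJA : J(A | A ^ 4 + 16 * B ^ 4) = 1 := by
    rw [← jacobiSym.quadratic_reciprocity_one_mod_four (by lia) hA,
      jacobiSym.mod_left' (a₂ := (4 * (B : ℤ) ^ 2) ^ 2)]
    · apply jacobiSym.sq_one'
      have h2 : Nat.Coprime (4 * B ^ 2) A :=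
        Nat.Coprime.mul_left (Nat.Coprime.pow_left 2 hA.coprime_two_left) (hAB.symm.pow_left 2)
      exact_mod_cast h2
    · refine Int.emod_eq_emod_iff_emod_sub_eq_zero.mpr (Int.emod_eq_zero_of_dvd ⟨(A : ℤ) ^ 3, ?_⟩)
      push_cast
      ring
  have hJB : J(B | A ^ 4 + 16 * B ^ 4) = 1 := by
    rw [← jacobiSym.quadratic_reciprocity_one_mod_four (by lia) hB,
      jacobiSym.mod_left' (a₂ := ((A : ℤ) ^ 2) ^ 2)]
    · apply jacobiSym.sq_one'
      exact_mod_cast hAB.pow_left 2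
    · refine Int.emod_eq_emod_iff_emod_sub_eq_zero.mpr
        (Int.emod_eq_zero_of_dvd ⟨16 * (B : ℤ) ^ 3, ?_⟩)
      push_cast
      ring
  have hJD : J((A ^ 2 + 4 * B ^ 2 : ℕ) | A ^ 4 + 16 * B ^ 4) = -1 := by
    rw [← jacobiSym.quadratic_reciprocity_one_mod_four (by lia) hDodd,
      jacobiSym.mod_left' (a₂ := -2 * (2 * (A : ℤ) * B) ^ 2)]
    · rw [jacobiSym.mul_left, jacobiSym.sq_one', jacobiSym.at_neg_two hDodd,
        ZMod.χ₈'_nat_eq_if_mod_eight, if_neg (by lia), if_neg (by lia), mul_one]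
      have hcA : Nat.Coprime A (A ^ 2 + 4 * B ^ 2) := by
        rw [sq, Nat.coprime_mul_left_add_right]
        exact Nat.Coprime.mul_right (Nat.Coprime.pow_right 2 hA.coprime_two_right) (hAB.pow_right 2)
      have hcB : Nat.Coprime B (A ^ 2 + 4 * B ^ 2) := by
        rw [show A ^ 2 + 4 * B ^ 2 = A ^ 2 + B * (4 * B) by ring,
          Nat.coprime_add_mul_left_right]
        exact hAB.symm.pow_right 2
      have h2 : Nat.Coprime (2 * A * B) (A ^ 2 + 4 * B ^ 2) :=
        (hDodd.coprime_two_left.mul_left hcA).mul_left hcB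
      exact_mod_cast h2
    · refine Int.emod_eq_emod_iff_emod_sub_eq_zero.mpr
        (Int.emod_eq_zero_of_dvd ⟨(A : ℤ) ^ 2 + 4 * B ^ 2, ?_⟩)
      push_cast
      ring
  rw [jacobiSym.mul_left, jacobiSym.mul_left, hJA, hJB, hJD]
  norm_num

lemma jacobiSym_neg_one_and_two_of_dvd_pow_four_add {A B q : ℕ} (hA : Odd A)
    (hAB : A.Coprime B) (hq : q.Prime) (hqN : q ∣ A ^ 4 + 16 * B ^ 4) :
    ¬ (q : ℤ) ∣ 2 ∧ ¬ (q : ℤ) ∣ A ∧ ¬ (q : ℤ) ∣ B ∧ J(-1 | q) = 1 ∧ J(2 | q) = 1 := by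
  have hqZ : Prime (q : ℤ) := Nat.prime_iff_prime_int.mp hq
  obtain ⟨hAN, hBN, -⟩ := coprime_pow_four_add hA hAB
  have hqA : ¬ (q : ℤ) ∣ A := fun h =>
    hq.one_lt.ne' (Nat.eq_one_of_dvd_coprimes hAN (Int.natCast_dvd_natCast.mp h) hqN)
  have hqB : ¬ (q : ℤ) ∣ B := fun h =>
    hq.one_lt.ne' (Nat.eq_one_of_dvd_coprimes hBN (Int.natCast_dvd_natCast.mp h) hqN)
  have hq2 : ¬ (q : ℤ) ∣ 2 := fun h => by
    have h2 : q ∣ 2 := by exact_mod_cast h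
    rw [(Nat.prime_dvd_prime_iff_eq hq Nat.prime_two).mp h2] at hqN
    have := pow_four_add_mod_eight B hA
    lia
  have hN : (q : ℤ) ∣ (A : ℤ) ^ 4 + 16 * (B : ℤ) ^ 4 := by exact_mod_cast hqN
  refine ⟨hq2, hqA, hqB, ?_, ?_⟩
  · refine (jacobiSym_eq_of_dvd_mul_sq_sub hq (b := 1) (v := A ^ 2) (u := 4 * B ^ 2)
      (fun h => hqZ.not_isUnit (isUnit_of_dvd_unit h isUnit_one.neg))
      (fun h => hqA (hqZ.dvd_of_dvd_pow h)) ?_).trans (jacobiSym.one_left q)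
    have := hN.neg_right
    ring_nf at this ⊢
    exact this
  · refine (jacobiSym_eq_of_dvd_mul_sq_sub hq (b := 1) (v := 2 * A * B) (u := A ^ 2 + 4 * B ^ 2) hq2
      (fun h => ?_) ?_).trans (jacobiSym.one_left q)
    · rcases hqZ.dvd_or_dvd h with h | h
      · exact (hqZ.dvd_or_dvd h).elim hq2 hqA
      · exact hqB h
    · have := hN.neg_right
      ring_nf at this ⊢
      exact this

/-- The primes dividing `y` on a twist `2y² = z⁴ - ml²w⁴`, away from `2`, have `m` as a
quadratic residue. -/
lemma jacobiSym_eq_one_of_dvd_of_two_mul_sq_eq {m l q : ℕ} (hm : Squarefree m)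
    (hl : Squarefree l) (hq : q.Prime) (hq2 : ¬ (q : ℤ) ∣ 2)
    (hql : q ∣ l → J(-1 | q) = 1 ∧ J(2 | q) = 1) {y z w : ℤ} (hzw : IsCoprime z w)
    (h : 2 * y ^ 2 = z ^ 4 - m * l ^ 2 * w ^ 4) (hqy : (q : ℤ) ∣ y) :
    ¬ (q : ℤ) ∣ m ∧ J(m | q) = 1 := by
  have hqZ : Prime (q : ℤ) := Nat.prime_iff_prime_int.mp hq
  have hq0 : (q : ℤ) ≠ 0 := hqZ.ne_zero
  have sqf : ∀ n : ℕ, Squarefree n → ∀ k : ℤ, (n : ℤ) = q * k → ¬ (q : ℤ) ∣ k := by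
    rintro n hn k hk ⟨j, rfl⟩
    have h1 : (q * q : ℕ) ∣ n := Int.natCast_dvd_natCast.mp ⟨j, by push_cast; rw [hk]; ring⟩
    exact hq.not_isUnit (hn q h1)
  have hqw : ¬ (q : ℤ) ∣ w := fun hw => by
    have hz : (q : ℤ) ∣ z ^ 4 := by
      have : z ^ 4 = 2 * y ^ 2 + m * l ^ 2 * w ^ 4 := by linarith
      rw [this]
      exact dvd_add ((dvd_pow hqy two_ne_zero).mul_left _) ((dvd_pow hw four_ne_zero).mul_left _)
    exact hqZ.not_isUnit (hzw.isUnit_of_dvd' (hqZ.dvd_of_dvd_pow hz) hw)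
  by_cases hqz : (q : ℤ) ∣ z
  · obtain ⟨y, rfl⟩ := hqy
    obtain ⟨z, rfl⟩ := hqz
    have hql' : (q : ℤ) ∣ l := by
      by_contra hcon
      have h1 : (q : ℤ) * q ∣ m * (l ^ 2 * w ^ 4) :=
        ⟨q ^ 2 * z ^ 4 - 2 * y ^ 2, by linear_combination h⟩
      have h2 : (q : ℤ) ∣ m := by
        rcases hqZ.dvd_or_dvd ((dvd_mul_right _ _).trans h1) with h | h
        · exact h
        · rcases hqZ.dvd_or_dvd h with h | h
          · exact absurd (hqZ.dvd_of_dvd_pow h) hcon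
          · exact absurd (hqZ.dvd_of_dvd_pow h) hqw
      obtain ⟨k, hk⟩ := h2
      rw [hk, mul_assoc] at h1
      rcases hqZ.dvd_or_dvd (Int.dvd_of_mul_dvd_mul_left hq0 h1) with h | h
      · exact sqf m hm k hk h
      · rcases hqZ.dvd_or_dvd h with h | h
        · exact hcon (hqZ.dvd_of_dvd_pow h)
        · exact hqw (hqZ.dvd_of_dvd_pow h)
    obtain ⟨k, hk⟩ := hql'
    have hqk := sqf l hl k hk
    have h1 : 2 * y ^ 2 = q ^ 2 * z ^ 4 - m * k ^ 2 * w ^ 4 := by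
      rw [hk] at h
      apply mul_left_cancel₀ (pow_ne_zero 2 hq0)
      linear_combination h
    have hqkw : ¬ (q : ℤ) ∣ k * w ^ 2 := fun h => (hqZ.dvd_or_dvd h).elim hqk
      fun h => hqw (hqZ.dvd_of_dvd_pow h)
    have hqm : ¬ (q : ℤ) ∣ m := by
      rintro ⟨j, hj⟩
      have hy : (q : ℤ) ∣ y := by
        have h3 : (q : ℤ) ∣ 2 * y ^ 2 :=
          ⟨q * z ^ 4 - j * k ^ 2 * w ^ 4, by rw [h1, hj]; ring⟩
        exact hqZ.dvd_of_dvd_pow ((hqZ.dvd_or_dvd h3).resolve_left hq2)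
      obtain ⟨y, rfl⟩ := hy
      have h3 : (q : ℤ) ∣ j * (k * w ^ 2) ^ 2 := by
        refine ⟨z ^ 4 - 2 * y ^ 2, ?_⟩
        rw [hj] at h1
        apply mul_left_cancel₀ hq0
        linear_combination h1
      rcases hqZ.dvd_or_dvd h3 with h | h
      · exact sqf m hm j hj h
      · exact hqkw (hqZ.dvd_of_dvd_pow h)
    obtain ⟨hneg, htwo⟩ := hql (Int.natCast_dvd_natCast.mp ⟨k, hk⟩)
    refine ⟨hqm, ?_⟩
    rw [jacobiSym_eq_of_dvd_mul_sq_sub hq (b := -1 * 2) (u := y) hqm hqkw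
      ⟨q * z ^ 4, by linear_combination h1⟩, jacobiSym.mul_left, hneg, htwo, mul_one]
  · have hlm : ¬ (q : ℤ) ∣ m * (l * w ^ 2) ^ 2 := by
      intro h3
      apply hqz
      have : (q : ℤ) ∣ z ^ 4 := by
        rw [show z ^ 4 = 2 * y ^ 2 + m * (l * w ^ 2) ^ 2 by linear_combination -h]
        exact dvd_add ((dvd_pow hqy two_ne_zero).mul_left _) h3
      exact hqZ.dvd_of_dvd_pow this
    have hqm : ¬ (q : ℤ) ∣ m := fun h => hlm (h.mul_right _)
    refine ⟨hqm, ?_⟩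
    refine (jacobiSym_eq_of_dvd_mul_sq_sub hq (b := 1) (v := l * w ^ 2) (u := z ^ 2) hqm
      (fun h => hlm ((dvd_pow h two_ne_zero).mul_left _)) ?_).trans (jacobiSym.one_left q)
    rw [show (m : ℤ) * (l * w ^ 2) ^ 2 - 1 * (z ^ 2) ^ 2 = -(2 * y ^ 2) by linear_combination h]
    exact ((dvd_pow hqy two_ne_zero).mul_left _).neg_right

lemma two_mul_sq_ne_of_isCoprime {A B : ℕ} (hA : Odd A) (hB : Odd B) (hAB : A.Coprime B)
    {m l c : ℕ} (hm : Squarefree m) (hl : Squarefree l)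
    (hN : m * l ^ 2 * c ^ 4 = A ^ 4 + 16 * B ^ 4) {y z w : ℤ} (hy : y ≠ 0)
    (hzw : IsCoprime z w) : 2 * y ^ 2 ≠ z ^ 4 - m * l ^ 2 * w ^ 4 := by
  intro h
  have hmN : m ∣ A ^ 4 + 16 * B ^ 4 := ⟨l ^ 2 * c ^ 4, by rw [← hN]; ring⟩
  have hlN : l ∣ A ^ 4 + 16 * B ^ 4 := ⟨m * l * c ^ 4, by rw [← hN]; ring⟩
  have hN' : A ^ 4 + 16 * B ^ 4 = m * (l * c ^ 2) ^ 2 := by rw [← hN]; ring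
  have hNmod := pow_four_add_mod_eight B hA
  have hm8 : m % 8 = 1 := by
    have hodd : Odd (l * c ^ 2) := by
      by_contra hcon
      obtain ⟨k, hk⟩ := Nat.not_odd_iff_even.mp hcon
      rw [hN', hk, show m * (k + k) ^ 2 = 4 * (m * k ^ 2) by ring] at hNmod
      lia
    have hsq : (l * c ^ 2) ^ 2 % 8 = 1 := by
      have h3 := Nat.odd_iff.mp hodd
      have h2 : (l * c ^ 2) % 8 = 1 ∨ (l * c ^ 2) % 8 = 3 ∨ (l * c ^ 2) % 8 = 5 ∨
        (l * c ^ 2) % 8 = 7 := by lia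
      rcases h2 with h2 | h2 | h2 | h2 <;> rw [Nat.pow_mod, h2]
    rw [hN', Nat.mul_mod, hsq] at hNmod
    lia
  have not_dvd_two : ∀ q : ℕ, q.Prime → q ≠ 2 → ¬ (q : ℤ) ∣ 2 := fun q hq hq2 hd =>
    hq2 ((Nat.prime_dvd_prime_iff_eq hq Nat.prime_two).mp (by exact_mod_cast hd))
  have hql : ∀ q : ℕ, q.Prime → q ∣ l → J(-1 | q) = 1 ∧ J(2 | q) = 1 := fun q hq hd =>
    (jacobiSym_neg_one_and_two_of_dvd_pow_four_add hA hAB hq (hd.trans hlN)).2.2.2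
  have hJabs : J(y.natAbs | m) = 1 :=
    jacobiSym_eq_one_of_forall_prime_left hm8 _ (Int.natAbs_ne_zero.mpr hy) fun q hq hq2 hqy =>
      (jacobiSym_eq_one_of_dvd_of_two_mul_sq_eq hm hl hq (not_dvd_two q hq hq2) (hql q hq) hzw h
        (Int.natCast_dvd.mpr hqy)).2
  have hJy : J(y | m) = 1 := by
    rcases Int.natAbs_eq y with h' | h' <;> rw [h']
    · exact hJabs
    · rw [jacobiSym.neg _ (Nat.odd_iff.mpr (by lia)), hJabs, ZMod.χ₄_nat_one_mod_four (by lia),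
        mul_one]
  have hJyX : J(y * (((A ^ 2 + 4 * B ^ 2 : ℕ) : ℤ) * (A * B)) | m) = 1 := by
    refine jacobiSym_eq_one_of_forall_prime_right m (by lia) fun q hq hqm => ?_
    have hqZ : Prime (q : ℤ) := Nat.prime_iff_prime_int.mp hq
    obtain ⟨hq2, hqA, hqB, hneg, htwo⟩ :=
      jacobiSym_neg_one_and_two_of_dvd_pow_four_add hA hAB hq (hqm.trans hmN)
    have hqmZ : (q : ℤ) ∣ m := Int.natCast_dvd_natCast.mpr hqm
    have hqy : ¬ (q : ℤ) ∣ y := fun hd =>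
      (jacobiSym_eq_one_of_dvd_of_two_mul_sq_eq hm hl hq hq2 (hql q hq) hzw h hd).1 hqmZ
    have hqz : ¬ (q : ℤ) ∣ z := fun hd => by
      have h3 : (q : ℤ) ∣ 2 * y ^ 2 := by
        rw [h, mul_assoc]
        exact dvd_sub (dvd_pow hd four_ne_zero) (hqmZ.mul_right _)
      exact hqy (hqZ.dvd_of_dvd_pow ((hqZ.dvd_or_dvd h3).resolve_left hq2))
    have hzAB : ((z * A * B).gcd q) = 1 := by
      rw [← Int.isCoprime_iff_gcd_eq_one]
      refine ((Prime.coprime_iff_not_dvd hqZ).mpr fun hd => ?_).symm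
      rcases hqZ.dvd_or_dvd hd with hd | hd
      · exact (hqZ.dvd_or_dvd hd).elim hqz hqA
      · exact hqB hd
    have hprod : (q : ℤ) ∣ 2 * ((y * (A ^ 2 + 4 * B ^ 2) - 2 * z ^ 2 * A * B) *
        (y * (A ^ 2 + 4 * B ^ 2) + 2 * z ^ 2 * A * B)) := by
      have hNZ : (q : ℤ) ∣ (A : ℤ) ^ 4 + 16 * (B : ℤ) ^ 4 := by exact_mod_cast hqm.trans hmN
      obtain ⟨j, hj⟩ := hqmZ
      obtain ⟨i, hi⟩ := hNZ
      refine ⟨-(j * l ^ 2 * w ^ 4 * (A ^ 2 + 4 * B ^ 2) ^ 2) + z ^ 4 * i, ?_⟩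
      rw [hj] at h
      linear_combination (A ^ 2 + 4 * B ^ 2 : ℤ) ^ 2 * h + z ^ 4 * hi
    rcases hqZ.dvd_or_dvd ((hqZ.dvd_or_dvd hprod).resolve_left hq2) with ⟨k, hk⟩ | ⟨k, hk⟩
    · rw [jacobiSym.mod_left' (a₂ := 2 * (z * A * B) ^ 2), jacobiSym.mul_left, htwo,
        jacobiSym.sq_one' hzAB, mul_one]
      refine Int.emod_eq_emod_iff_emod_sub_eq_zero.mpr (Int.emod_eq_zero_of_dvd ⟨k * A * B, ?_⟩)
      push_cast
      linear_combination (A * B : ℤ) * hk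
    · rw [jacobiSym.mod_left' (a₂ := -1 * 2 * (z * A * B) ^ 2), jacobiSym.mul_left,
        jacobiSym.mul_left, hneg, htwo, jacobiSym.sq_one' hzAB, mul_one, mul_one]
      refine Int.emod_eq_emod_iff_emod_sub_eq_zero.mpr (Int.emod_eq_zero_of_dvd ⟨k * A * B, ?_⟩)
      push_cast
      linear_combination (A * B : ℤ) * hk
  rw [jacobiSym.mul_left, hJy, one_mul] at hJyX
  have hJN := jacobiSym_pow_four_add hA hB hAB
  have hlc : l * c ^ 2 ≠ 0 := fun h0 => by
    rw [hN', h0] at hNmod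
    simp at hNmod
  rw [hN', jacobiSym.mul_right' _ (by lia) (pow_ne_zero 2 hlc), hJyX, one_mul,
    jacobiSym.pow_right] at hJN
  nlinarith [sq_nonneg J(((A ^ 2 + 4 * B ^ 2 : ℕ) : ℤ) * (A * B) | l * c ^ 2)]

lemma exists_int_eq_of_two_mul_sq_eq {x : ℚ} {n : ℤ} (h : 2 * x ^ 2 = n) : ∃ k : ℤ, x = k := by
  have h2 : (2 * x) ^ 2 = ((2 * n : ℤ) : ℚ) := by push_cast; linear_combination 2 * h
  have hsq : IsSquare ((2 * n : ℤ) : ℚ) := ⟨2 * x, by rw [← h2, sq]⟩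
  obtain ⟨k, hk⟩ := Rat.isSquare_intCast_iff.mp hsq
  have hk2 : (2 : ℤ) ∣ k := by
    have : (2 : ℤ) ∣ k * k := ⟨n, hk.symm⟩
    exact (Int.prime_two.dvd_or_dvd this).elim id id
  obtain ⟨j, rfl⟩ := hk2
  have h3 : x ^ 2 = (j : ℚ) ^ 2 := by
    have h4 : ((2 * n : ℤ) : ℚ) = ((2 * j * (2 * j) : ℤ) : ℚ) := by rw [hk]
    push_cast at h4
    linear_combination h / 2 + h4 / 4
  rcases sq_eq_sq_iff_eq_or_eq_neg.mp h3 with h4 | h4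
  · exact ⟨j, h4⟩
  · exact ⟨-j, by push_cast; exact h4⟩

/-- The twisted Reichardt–Lind curve `2y² = z⁴ - (A⁴ + 16B⁴)`, `y ≠ 0`, has no rational points
when `A` and `B` are odd and coprime. -/
lemma two_mul_sq_ne_pow_four_sub_s10 {A B : ℕ} (hA : Odd A) (hB : Odd B) (hAB : A.Coprime B)
    {y z : ℚ} (hy : y ≠ 0) : 2 * y ^ 2 ≠ z ^ 4 - (A ^ 4 + 16 * B ^ 4) := by
  intro h
  obtain ⟨m, b, hN, hm⟩ := Nat.sq_mul_squarefree (A ^ 4 + 16 * B ^ 4)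
  obtain ⟨l, c, rfl, hl⟩ := Nat.sq_mul_squarefree b
  have hN' : m * l ^ 2 * c ^ 4 = A ^ 4 + 16 * B ^ 4 := by rw [← hN]; ring
  have hc : (c : ℚ) ≠ 0 := by
    rintro h0
    rw [Nat.cast_eq_zero.mp h0] at hN'
    have := pow_four_add_mod_eight B hA
    rw [← hN'] at this
    simp at this
  have hNQ : (m : ℚ) * l ^ 2 * c ^ 4 = A ^ 4 + 16 * B ^ 4 := by exact_mod_cast hN'
  set x : ℚ := z / c with hx
  have hzx : z = x * c := by rw [hx]; field_simp
  clear_value x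
  have hden : (x.den : ℚ) ≠ 0 := by exact_mod_cast x.den_ne_zero
  have hxnum : x * x.den = x.num := Rat.mul_den_eq_num x
  have hpt : 2 * (y * x.den ^ 2 / c ^ 2) ^ 2 =
      ((x.num ^ 4 - m * l ^ 2 * (x.den : ℤ) ^ 4 : ℤ) : ℚ) := by
    push_cast
    rw [← hxnum]
    rw [hzx, ← hNQ] at h
    field_simp
    linear_combination h
  obtain ⟨k, hk⟩ := exists_int_eq_of_two_mul_sq_eq hpt
  have hk0 : k ≠ 0 := by
    rintro rfl
    have : y * x.den ^ 2 / c ^ 2 ≠ 0 := by positivity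
    exact this (by simpa using hk)
  rw [hk] at hpt
  exact two_mul_sq_ne_of_isCoprime hA hB hAB hm hl hN' hk0
    (Rat.isCoprime_num_den x) (by exact_mod_cast hpt)

/-- Every member of Elkies' isotrivial family `2y² = z⁴ − N(t)`, `y ≠ 0`, with
`N(t) = (1 + 2/(1+t+t²))⁴ + 16`, has no rational points. -/
theorem elkies_family_no_rational_points (t : ℚ) :
    ¬ ∃ y z : ℚ, y ≠ 0 ∧
      2 * y ^ 2 = z ^ 4 - ((1 + 2 / (1 + t + t ^ 2)) ^ 4 + 16) := by
  rintro ⟨y, z, hy, h⟩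
  set r : ℤ := t.num with hr
  set s : ℤ := (t.den : ℤ) with hs
  have hrs : IsCoprime r s := Rat.isCoprime_num_den t
  have hs0 : (s : ℚ) ≠ 0 := by rw [hs]; exact_mod_cast t.den_ne_zero
  have ht : t * s = r := by rw [hs, hr]; exact_mod_cast Rat.mul_den_eq_num t
  obtain ⟨A, hA⟩ := Int.eq_ofNat_of_zero_le
    (show 0 ≤ r ^ 2 + r * s + 3 * s ^ 2 by nlinarith [sq_nonneg (r + s), sq_nonneg r, sq_nonneg s])
  obtain ⟨B, hB⟩ := Int.eq_ofNat_of_zero_le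
    (show 0 ≤ r ^ 2 + r * s + s ^ 2 by nlinarith [sq_nonneg (r + s), sq_nonneg r, sq_nonneg s])
  have hBZ : Odd (B : ℤ) := by
    have hnot : ¬ (Even r ∧ Even s) := fun ⟨h1, h2⟩ =>
      Int.prime_two.not_isUnit (hrs.isUnit_of_dvd' h1.two_dvd h2.two_dvd)
    rw [← hB]
    rcases Int.even_or_odd r with h1 | h1 <;> rcases Int.even_or_odd s with h2 | h2
    · exact absurd ⟨h1, h2⟩ hnot
    all_goals
      simp only [← Int.not_even_iff_odd] at *
      simp [Int.even_add, Int.even_mul, Int.even_pow, h1, h2]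
  have hABs : (A : ℤ) = B + 2 * s ^ 2 := by rw [← hA, ← hB]; ring
  have hAZ : Odd (A : ℤ) := by
    rw [hABs]
    exact hBZ.add_even (even_two_mul _)
  have hAB : A.Coprime B := by
    refine Nat.coprime_of_dvd fun q hq hqA hqB => ?_
    have hqZ : Prime (q : ℤ) := Nat.prime_iff_prime_int.mp hq
    have hqAZ : (q : ℤ) ∣ A := Int.natCast_dvd_natCast.mpr hqA
    have hqBZ : (q : ℤ) ∣ B := Int.natCast_dvd_natCast.mpr hqB
    have h2s : (q : ℤ) ∣ 2 * s ^ 2 := (dvd_add_right hqBZ).mp (hABs ▸ hqAZ)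
    rcases hqZ.dvd_or_dvd h2s with h2 | h2
    · have h2' : q ∣ 2 := by exact_mod_cast h2
      rw [(Nat.prime_dvd_prime_iff_eq hq Nat.prime_two).mp h2'] at hqBZ
      exact Int.not_even_iff_odd.mpr hBZ (even_iff_two_dvd.mpr hqBZ)
    · have hqs := hqZ.dvd_of_dvd_pow h2
      have hqr : (q : ℤ) ∣ r ^ 2 := by
        rw [show r ^ 2 = B - s * (r + s) by rw [← hB]; ring]
        exact dvd_sub hqBZ (hqs.mul_right _)
      exact hqZ.not_isUnit (hrs.isUnit_of_dvd' (hqZ.dvd_of_dvd_pow hqr) hqs)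
  have hB0 : (B : ℚ) ≠ 0 := by
    rintro h0
    rw [Nat.cast_eq_zero.mp h0] at hBZ
    simp at hBZ
  have hBQ : (B : ℚ) = (1 + t + t ^ 2) * s ^ 2 := by
    have : ((r ^ 2 + r * s + s ^ 2 : ℤ) : ℚ) = ((B : ℤ) : ℚ) := by rw [hB]
    push_cast at this
    rw [← this, ← ht]
    ring
  have hAQ : (A : ℚ) = (3 + t + t ^ 2) * s ^ 2 := by
    have : ((r ^ 2 + r * s + 3 * s ^ 2 : ℤ) : ℚ) = ((A : ℤ) : ℚ) := by rw [hA]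
    push_cast at this
    rw [← this, ← ht]
    ring
  have ht0 : 1 + t + t ^ 2 ≠ 0 := fun h0 => hB0 (by rw [hBQ, h0, zero_mul])
  have hquot : 1 + 2 / (1 + t + t ^ 2) = (A : ℚ) / B := by
    rw [hAQ, hBQ]
    field_simp
    ring
  rw [hquot] at h
  refine two_mul_sq_ne_pow_four_sub_s10 (y := y * B ^ 2) (z := z * B) (by exact_mod_cast hAZ)
    (by exact_mod_cast hBZ) hAB (by positivity) ?_
  field_simp at h
  linear_combination h
end

section
/- Let G be a group, N a finite normal subgroup of G, Q = G/N the quotient group and π : G → Q the quotient homomorphism. Let s, t : Q → G be two group homomorphisms with π ∘ s = id and π ∘ t = id. Then there exists a subgroup H of Q whose index in Q divides |Aut(N)|²·|Z(N)|, where Aut(N) is the automorphism group of N and Z(N) its center, such that s and t agree on H. -/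
theorem MonoidHom.index_ker_dvd_card {G M : Type*} [Group G] [Group M] (f : G →* M) :
    f.ker.index ∣ Nat.card M := by
  rw [Subgroup.index_ker]
  exact Subgroup.card_subgroup_dvd_card f.range

/-- Two homomorphisms that agree modulo a normal subgroup `N`, and whose values all act trivially
on `N` by conjugation, differ by a homomorphism to the center of `N`. -/
def MonoidHom.divToCenter {K G : Type*} [Group K] [Group G] {N : Subgroup G} [N.Normal]
    (s t : K →* G) (hst : ∀ x, s x / t x ∈ N)
    (hs : ∀ x, MulAut.conjNormal (H := N) (s x) = 1)
    (ht : ∀ x, MulAut.conjNormal (H := N) (t x) = 1) : K →* Subgroup.center ↥N where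
  toFun x := ⟨⟨s x / t x, hst x⟩, by
    have h : MulAut.conjNormal (H := N) (s x / t x) = 1 := by rw [map_div, hs, ht, div_one]
    refine Subgroup.mem_center_iff.2 fun n ↦ Subtype.ext ?_
    have hn := congrArg Subtype.val (DFunLike.congr_fun h n)
    rw [MulAut.conjNormal_apply, MulAut.one_apply, mul_inv_eq_iff_eq_mul] at hn
    exact hn.symm⟩
  map_one' := by simp
  map_mul' x y := by
    refine Subtype.ext (Subtype.ext ?_)
    have hc := congrArg Subtype.val (DFunLike.congr_fun (ht x) ⟨s y / t y, hst y⟩)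
    rw [MulAut.conjNormal_apply, MulAut.one_apply, mul_inv_eq_iff_eq_mul] at hc
    change s (x * y) / t (x * y) = s x / t x * (s y / t y)
    calc s (x * y) / t (x * y) = s x * (s y / t y) * (t x)⁻¹ := by
          simp only [map_mul, div_eq_mul_inv, mul_inv_rev, mul_assoc]
      _ = s x * ((t x)⁻¹ * (t x * (s y / t y))) * (t x)⁻¹ := by rw [inv_mul_cancel_left]
      _ = s x / t x * (s y / t y) := by
          rw [show t x * (s y / t y) = s y / t y * t x from hc]
          simp only [div_eq_mul_inv, mul_assoc, mul_inv_cancel, mul_one]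

/-- Two sections of an extension of `Q = G/N` by a finite group `N` agree on a
subgroup of `Q` whose index divides `|Aut(N)|² · |Z(N)|`. -/
theorem sections_agree_on_bounded_index_subgroup
    (G : Type*) [Group G] (N : Subgroup G) [N.Normal] [Finite ↥N]
    (s t : G ⧸ N →* G)
    (hs : (QuotientGroup.mk' N).comp s = MonoidHom.id (G ⧸ N))
    (ht : (QuotientGroup.mk' N).comp t = MonoidHom.id (G ⧸ N)) :
    ∃ H : Subgroup (G ⧸ N),
      H.index ∣ Nat.card (MulAut ↥N) ^ 2 * Nat.card (Subgroup.center ↥N) ∧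
      ∀ x ∈ H, s x = t x := by
  let φ : G ⧸ N →* MulAut ↥N × MulAut ↥N :=
    (MulAut.conjNormal.comp s).prod (MulAut.conjNormal.comp t)
  have hφ (x : φ.ker) : φ x = 1 := x.2
  let c : φ.ker →* Subgroup.center ↥N :=
    MonoidHom.divToCenter (s.comp φ.ker.subtype) (t.comp φ.ker.subtype)
      (fun x ↦ by
        have h₁ := DFunLike.congr_fun hs (x : G ⧸ N)
        have h₂ := DFunLike.congr_fun ht (x : G ⧸ N)
        refine (QuotientGroup.eq_one_iff _).1 ?_
        exact (map_div (QuotientGroup.mk' N) _ _).trans (div_eq_one.2 (h₁.trans h₂.symm)))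
      (fun x ↦ congrArg Prod.fst (hφ x))
      (fun x ↦ congrArg Prod.snd (hφ x))
  refine ⟨c.ker.map φ.ker.subtype, ?_, ?_⟩
  · rw [Subgroup.index_map_subtype, mul_comm, sq, ← Nat.card_prod]
    exact mul_dvd_mul φ.index_ker_dvd_card c.index_ker_dvd_card
  · rintro _ ⟨x, hx, rfl⟩
    exact div_eq_one.1 (congrArg (fun z : Subgroup.center ↥N ↦ ((z : ↥N) : G)) hx)
end

section
/- Let G be a group, N a finite normal subgroup of G, Q = G/N the quotient group and π : G → Q the quotient homomorphism. Assume that Q has only finitely many subgroups of index dividing |Aut(N)|²·|Z(N)|, where Aut(N) is the automorphism group of N and Z(N) its center. Then the set of group homomorphisms s : Q → G with π ∘ s = id is finite. -/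
/-- There are only finitely many functions to a finite type that are constant on the left cosets
of a given subgroup of finite index. -/
theorem finite_setOf_constant_on_cosets {Q A : Type*} [Group Q] [Finite A] (L : Subgroup Q)
    [L.FiniteIndex] : {f : Q → A | ∀ q, ∀ l ∈ L, f (q * l) = f q}.Finite := by
  refine (Set.finite_range fun (g : Q ⧸ L → A) (q : Q) => g q).subset fun f hf => ?_
  refine ⟨fun x => Quotient.liftOn' x f fun a b hab => ?_, rfl⟩
  have h := hf a (a⁻¹ * b) (QuotientGroup.leftRel_apply.mp hab)
  rwa [mul_inv_cancel_left, eq_comm] at h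

/-- A group with finitely many subgroups of index dividing the order of a finite group `A` has
finitely many homomorphisms to `A`. -/
theorem MonoidHom.finite_of_finite_index_dvd {Q A : Type*} [Group Q] [Group A] [Finite A]
    (h : {H : Subgroup Q | H.index ∣ Nat.card A}.Finite) : Finite (Q →* A) := by
  refine Set.finite_univ_iff.mp (Set.Finite.of_finite_fibers MonoidHom.ker (h.subset ?_) ?_)
  · rintro _ ⟨f, -, rfl⟩
    simpa only [Set.mem_ofPred_eq, Subgroup.index_ker] using Subgroup.card_subgroup_dvd_card f.range
  · rintro _ ⟨f, -, rfl⟩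
    have : f.ker.FiniteIndex := inferInstance
    refine Set.Finite.of_finite_image
      ((finite_setOf_constant_on_cosets (A := A) f.ker).subset ?_) DFunLike.coe_injective.injOn
    rintro _ ⟨g, ⟨-, hg⟩, rfl⟩ q l hl
    rw [← show g.ker = f.ker from hg] at hl
    rw [map_mul, MonoidHom.mem_ker.mp hl, mul_one]

section Sections

variable {G : Type*} [Group G] {N : Subgroup G} [N.Normal]

theorem mul_inv_mem_of_isSection {s t : G ⧸ N →* G}
    (hs : (QuotientGroup.mk' N).comp s = MonoidHom.id (G ⧸ N))
    (ht : (QuotientGroup.mk' N).comp t = MonoidHom.id (G ⧸ N)) (q : G ⧸ N) :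
    s q * (t q)⁻¹ ∈ N := by
  have h₁ : QuotientGroup.mk' N (s q) = q := DFunLike.congr_fun hs q
  have h₂ : QuotientGroup.mk' N (t q) = q := DFunLike.congr_fun ht q
  refine (QuotientGroup.eq_one_iff _).mp (?_ : QuotientGroup.mk' N _ = 1)
  rw [map_mul, map_inv, h₁, h₂, mul_inv_cancel]

theorem commute_of_conjNormal_eq_one {g n : G} (hg : MulAut.conjNormal (H := N) g = 1)
    (hn : n ∈ N) : Commute g n := by
  have h := congrArg Subtype.val (DFunLike.congr_fun hg ⟨n, hn⟩)
  rw [MulAut.conjNormal_apply] at h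
  exact mul_inv_eq_iff_eq_mul.mp h

/-- Two sections inducing the same action on `N` agree on a subgroup of the kernel of the action
whose index divides `|Aut(N)| · |Z(N)|`. -/
theorem index_ker_inf_eqLocus_dvd [Finite N] {s t : G ⧸ N →* G}
    (hs : (QuotientGroup.mk' N).comp s = MonoidHom.id (G ⧸ N))
    (ht : (QuotientGroup.mk' N).comp t = MonoidHom.id (G ⧸ N))
    (hst : (MulAut.conjNormal (H := N)).comp s = (MulAut.conjNormal (H := N)).comp t) :
    (((MulAut.conjNormal (H := N)).comp t).ker ⊓ s.eqLocus t).index ∣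
      Nat.card (MulAut N) * Nat.card (Subgroup.center N) := by
  set K := ((MulAut.conjNormal (H := N)).comp t).ker with hK
  have conj_t (k : K) : MulAut.conjNormal (H := N) (t k) = 1 := k.2
  have conj_s (k : K) : MulAut.conjNormal (H := N) (s k) = 1 :=
    (DFunLike.congr_fun hst (k : G ⧸ N)).trans k.2
  let c : K →* G :=
    { toFun := fun k => s k * (t k)⁻¹
      map_one' := by simp
      map_mul' := fun a b => by
        have h := (commute_of_conjNormal_eq_one (conj_t a)
          (mul_inv_mem_of_isSection hs ht b)).inv_left.eq
        simp only [Subgroup.coe_mul, map_mul, mul_inv_rev]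
        rw [mul_assoc (s a) (t a)⁻¹, h]
        group }
  have hc : c.range ≤ (Subgroup.center N).map N.subtype := by
    rintro _ ⟨k, rfl⟩
    refine ⟨⟨c k, mul_inv_mem_of_isSection hs ht k⟩, ?_, rfl⟩
    refine Subgroup.mem_center_iff.mpr fun n => Subtype.ext ?_
    exact ((commute_of_conjNormal_eq_one (conj_s k) n.2).mul_left
      (commute_of_conjNormal_eq_one (conj_t k) n.2).inv_left).eq.symm
  have hker : (K ⊓ s.eqLocus t).subgroupOf K = c.ker := by
    ext k
    rw [Subgroup.mem_subgroupOf, Subgroup.mem_inf, MonoidHom.mem_ker]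
    exact ⟨fun h => mul_inv_eq_one.mpr h.2, fun h => ⟨k.2, mul_inv_eq_one.mp h⟩⟩
  rw [← Subgroup.relIndex_mul_index (inf_le_left : K ⊓ s.eqLocus t ≤ K), mul_comm]
  refine mul_dvd_mul ?_ ?_
  · rw [hK, Subgroup.index_ker]
    exact Subgroup.card_subgroup_dvd_card _
  · rw [Subgroup.relIndex, hker, Subgroup.index_ker,
      ← Subgroup.card_map_of_injective N.subtype_injective]
    exact Subgroup.card_dvd_of_le hc

end Sections

/-- If `Q = G/N` has only finitely many subgroups of index dividing
`|Aut(N)|² · |Z(N)|`, with `N` a finite normal subgroup of `G`, then the extension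
`1 → N → G → Q → 1` has only finitely many sections. -/
theorem finitely_many_sections
    (G : Type*) [Group G] (N : Subgroup G) [N.Normal] [Finite ↥N]
    (hfin : {H : Subgroup (G ⧸ N) |
      H.index ∣ Nat.card (MulAut ↥N) ^ 2 * Nat.card (Subgroup.center ↥N)}.Finite) :
    {s : G ⧸ N →* G | (QuotientGroup.mk' N).comp s = MonoidHom.id (G ⧸ N)}.Finite := by
  have : Finite (MulAut N) := Finite.of_injective _ (DFunLike.coe_injective (F := MulAut N))
  have : Finite (G ⧸ N →* MulAut N) := MonoidHom.finite_of_finite_index_dvd <|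
    hfin.subset fun H hH => hH.trans ((dvd_pow_self _ two_ne_zero).mul_right _)
  refine Set.Finite.of_finite_fibers (fun s => (MulAut.conjNormal (H := N)).comp s)
    (Set.toFinite _) ?_
  rintro _ ⟨t, ht, rfl⟩
  refine Set.Finite.of_finite_fibers
    (fun s => ((MulAut.conjNormal (H := N)).comp t).ker ⊓ s.eqLocus t) (hfin.subset ?_) ?_
  · rintro _ ⟨s, ⟨hs, hst⟩, rfl⟩
    exact (index_ker_inf_eqLocus_dvd hs ht hst).trans
      (mul_dvd_mul_right (dvd_pow_self _ two_ne_zero) _)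
  · rintro L ⟨s₀, ⟨hs₀, hst₀⟩, rfl⟩
    have hindex := index_ker_inf_eqLocus_dvd hs₀ ht hst₀
    set L := ((MulAut.conjNormal (H := N)).comp t).ker ⊓ s₀.eqLocus t
    have : L.FiniteIndex :=
      ⟨ne_zero_of_dvd_ne_zero (mul_ne_zero Nat.card_pos.ne' Nat.card_pos.ne') hindex⟩
    refine (((finite_setOf_constant_on_cosets (A := N) L).image
      fun f q => (f q : G) * t q).preimage DFunLike.coe_injective.injOn).subset ?_
    rintro s ⟨⟨hs, -⟩, hL⟩
    refine ⟨fun q => ⟨s q * (t q)⁻¹, mul_inv_mem_of_isSection hs ht q⟩, fun q l hl => ?_, ?_⟩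
    · rw [← show _ = L from hL] at hl
      have h : s l = t l := hl.2
      refine Subtype.ext ?_
      simp only [map_mul, h, mul_inv_rev]
      group
    · funext q
      exact inv_mul_cancel_right _ _
end

section
/- Let R = ℤ[X]/(X² + X + 1) be the ring of Eisenstein integers and let M be a nonzero finite R-module whose cardinality is a power of 3 and whose underlying additive group is cyclic. Then M has exactly 3 elements (equivalently, M is isomorphic to ℤ/3ℤ as an abelian group). -/
theorem Int.not_nine_dvd_sq_add_self_add_one (n : ℤ) : ¬ (9 : ℤ) ∣ n ^ 2 + n + 1 := by
  intro h
  have h' := (ZMod.intCast_zmod_eq_zero_iff_dvd _ 9).2 (by exact_mod_cast h)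
  push_cast at h'
  generalize (n : ZMod 9) = m at h'
  revert m
  decide

/-- If a root of `X² + X + 1` acts on a finite cyclic group, the order of the group divides a
value of `X² + X + 1` at an integer. -/
theorem IsAddCyclic.exists_card_dvd_sq_add_self_add_one {R M : Type*} [Ring R] [AddCommGroup M]
    [Module R M] [IsAddCyclic M] {r : R} (hr : r ^ 2 + r + 1 = 0) :
    ∃ n : ℤ, (Nat.card M : ℤ) ∣ n ^ 2 + n + 1 := by
  obtain ⟨g, hg⟩ := IsAddCyclic.exists_generator (α := M)
  obtain ⟨n, hn⟩ := AddSubgroup.mem_zmultiples_iff.1 (hg (r • g))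
  refine ⟨n, ?_⟩
  rw [← addOrderOf_eq_card_of_forall_mem_zmultiples hg, addOrderOf_dvd_iff_zsmul_eq_zero]
  calc (n ^ 2 + n + 1) • g = (r ^ 2 + r + 1) • g := by
        simp only [add_smul, pow_two, mul_smul, one_smul, ← hn, smul_comm r n g]
    _ = 0 := by rw [hr, zero_smul]

/-- A nonzero finite module over the Eisenstein integers `ℤ[X]/(X² + X + 1)` of
`3`-power order whose underlying additive group is cyclic has exactly `3` elements. -/
theorem eisenstein_cyclic_module_card_three
    (M : Type*) [AddCommGroup M]
    [Module (Polynomial ℤ ⧸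
      Ideal.span ({Polynomial.X ^ 2 + Polynomial.X + 1} : Set (Polynomial ℤ))) M]
    [Finite M] [Nontrivial M]
    (h3 : ∃ k : ℕ, Nat.card M = 3 ^ k) (hcyc : IsAddCyclic M) :
    Nat.card M = 3 := by
  obtain ⟨k, hk⟩ := h3
  have hroot : Ideal.Quotient.mk (Ideal.span ({Polynomial.X ^ 2 + Polynomial.X + 1} :
      Set (Polynomial ℤ))) Polynomial.X ^ 2 + Ideal.Quotient.mk _ Polynomial.X + 1 = 0 := by
    rw [← map_pow, ← map_add, ← map_one (Ideal.Quotient.mk _), ← map_add,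
      Ideal.Quotient.eq_zero_iff_mem]
    exact Ideal.mem_span_singleton_self _
  obtain ⟨n, hn⟩ := IsAddCyclic.exists_card_dvd_sq_add_self_add_one (M := M) hroot
  match k with
  | 0 => exact absurd hk (by simpa using Finite.one_lt_card (α := M) |>.ne')
  | 1 => simpa using hk
  | k + 2 =>
    refine absurd (dvd_trans ?_ hn) (Int.not_nine_dvd_sq_add_self_add_one n)
    rw [hk, pow_add]
    push_cast
    exact Dvd.intro_left _ rfl
end

section
/- For all a, b in the field ℚ₃ of 3-adic numbers with b² = a³ − 24300, there exist u, v ∈ ℚ₃ with u ≠ 0, v² = u³ + 900, a = (u³ + 3600)/u² and b = v·(u³ − 7200)/u³. In other words, the degree-3 isogeny f : E' → E between the elliptic curves E' : v² = u³ + 900 and E : b² = a³ − 24300 given by (u,v) ↦ ((u³+3600)/u², v·(u³−7200)/u³) is surjective on ℚ₃-points. -/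
theorem PadicInt.sq_ne_cube_sub (a b : ℤ_[3]) (ha : 3 ∣ a) : b ^ 2 ≠ a ^ 3 - 24300 := by
  intro h
  have hp : Prime (3 : ℤ_[3]) := by exact_mod_cast PadicInt.prime_p (p := 3)
  obtain ⟨c, rfl⟩ := ha
  obtain ⟨d, rfl⟩ : 3 ∣ b :=
    hp.dvd_of_dvd_pow (n := 2) ⟨9 * (c ^ 3 - 900), by linear_combination h⟩
  have hd : d ^ 2 = 3 * (c ^ 3 - 900) :=
    mul_left_cancel₀ (pow_ne_zero 2 hp.ne_zero) (by linear_combination h)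
  obtain ⟨e, rfl⟩ : 3 ∣ d := hp.dvd_of_dvd_pow (n := 2) ⟨_, hd⟩
  have he : 3 * e ^ 2 = c ^ 3 - 900 := mul_left_cancel₀ hp.ne_zero (by linear_combination hd)
  obtain ⟨g, rfl⟩ : 3 ∣ c :=
    hp.dvd_of_dvd_pow (n := 3) ⟨e ^ 2 + 300, by linear_combination -he⟩
  have hg : e ^ 2 = 9 * g ^ 3 - 300 := mul_left_cancel₀ hp.ne_zero (by linear_combination he)
  obtain ⟨k, rfl⟩ : 3 ∣ e :=
    hp.dvd_of_dvd_pow (n := 2) ⟨3 * g ^ 3 - 100, by linear_combination hg⟩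
  have hk : 3 * k ^ 2 = 3 * g ^ 3 - 100 := mul_left_cancel₀ hp.ne_zero (by linear_combination hg)
  exact hp.not_isUnit (isUnit_of_dvd_one ⟨g ^ 3 - k ^ 2 - 33, by linear_combination hk⟩)

theorem Padic.one_le_norm_of_sq_eq_cube_sub {a b : ℚ_[3]} (hab : b ^ 2 = a ^ 3 - 24300) :
    1 ≤ ‖a‖ := by
  by_contra! ha
  have hb : ‖b‖ ≤ 1 := by
    rw [← pow_le_one_iff_of_nonneg (norm_nonneg b) two_ne_zero, ← norm_pow, hab]
    let x : ℤ_[3] := ⟨a, ha.le⟩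
    exact (x ^ 3 - 24300).2
  refine PadicInt.sq_ne_cube_sub ⟨a, ha.le⟩ ⟨b, hb⟩ ?_ (Subtype.ext hab)
  exact_mod_cast (PadicInt.norm_lt_one_iff_dvd (p := 3) ⟨a, ha.le⟩).1 ha

/-- If `‖c‖ < 1`, then `1` lifts to a root of `X³ - X² + c` by Hensel's lemma. -/
theorem PadicInt.exists_cube_sub_sq_add_eq_zero {p : ℕ} [Fact p.Prime] {c : ℤ_[p]}
    (hc : ‖c‖ < 1) : ∃ w : ℤ_[p], w ^ 3 - w ^ 2 + c = 0 := by
  let F : Polynomial ℤ_[p] := Polynomial.X ^ 3 - Polynomial.X ^ 2 + Polynomial.C c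
  have hF : ‖F.aeval (1 : ℤ_[p])‖ < ‖F.derivative.aeval (1 : ℤ_[p])‖ ^ 2 := by
    have h : (2 : ℤ_[p]) - 1 = 1 := by norm_num
    simpa [F, h] using hc
  obtain ⟨w, hw, -⟩ := hensels_lemma hF
  exact ⟨w, by simpa [F] using hw⟩

/-- The degree-3 isogeny `(u,v) ↦ ((u³+3600)/u², v(u³−7200)/u³)` from
`E' : v² = u³ + 900` to `E : b² = a³ − 24300` is surjective on `ℚ₃`-points. -/
theorem isogeny_surjective_on_Q3_points
    (a b : ℚ_[3]) (hab : b ^ 2 = a ^ 3 - 24300) :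
    ∃ u v : ℚ_[3], u ≠ 0 ∧ v ^ 2 = u ^ 3 + 900 ∧
      a = (u ^ 3 + 3600) / u ^ 2 ∧ b = v * (u ^ 3 - 7200) / u ^ 3 := by
  have ha := Padic.one_le_norm_of_sq_eq_cube_sub hab
  have ha0 : a ≠ 0 := norm_pos_iff.1 (one_pos.trans_le ha)
  have norm_lt {n : ℤ} (hn : 3 ∣ n) : ‖(n : ℚ_[3])‖ < 1 :=
    (PadicInt.norm_int_lt_one_iff_dvd (p := 3) n).2 (by exact_mod_cast hn)
  have hc : ‖3600 / a ^ 3‖ < 1 := by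
    rw [norm_div, norm_pow]
    refine (div_le_self (norm_nonneg _) (one_le_pow₀ ha)).trans_lt ?_
    exact_mod_cast norm_lt (n := 3600) (by norm_num)
  obtain ⟨w, hw⟩ := PadicInt.exists_cube_sub_sq_add_eq_zero (c := ⟨3600 / a ^ 3, hc.le⟩) hc
  have hw' : (w : ℚ_[3]) ^ 3 - (w : ℚ_[3]) ^ 2 + 3600 / a ^ 3 = 0 := congrArg Subtype.val hw
  obtain ⟨u, hu⟩ : ∃ u : ℚ_[3], u ^ 3 + 3600 = a * u ^ 2 := by
    refine ⟨a * w, ?_⟩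
    field_simp at hw'
    linear_combination hw'
  have hu0 : u ≠ 0 := by
    rintro rfl
    norm_num at hu
  have hau : a = (u ^ 3 + 3600) / u ^ 2 := by rw [hu]; field_simp
  have hu1 : u ^ 3 - 7200 ≠ 0 := by
    intro h
    have h3 : a ^ 3 = 24300 := by
      rw [hau, div_pow, div_eq_iff (pow_ne_zero 3 (pow_ne_zero 2 hu0))]
      linear_combination (u ^ 6 - 6300 * u ^ 3 - 6480000) * h
    have hn : ‖a ^ 3‖ < 1 := by
      rw [h3]
      exact_mod_cast norm_lt (n := 24300) (by norm_num)
    rw [norm_pow] at hn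
    exact hn.not_ge (one_le_pow₀ ha)
  refine ⟨u, b * u ^ 3 / (u ^ 3 - 7200), hu0, ?_, hau, by field_simp⟩
  rw [div_pow, mul_pow, hab, hau]
  field_simp
  ring
end
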